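/- arXiv:cs/0504023 — 9 statements merged into one kernel-verified Lean document; each statement's English description precedes it below -/
import Mathlib

section
/- For every sign labeling of the complete graph on a finite vertex set V of size n and every integer k ≥ 2, there exists a k-clustering c of V with agree(c) ≥ max(n₊, (1 − 1/k)·n₋), where n₊ is the number of edges labeled + and n₋ is the number of edges labeled −. -/
open Finset

/-- Whether both endpoints of an unordered pair lie in the same cluster. -/
def sameBlock {V : Type*} {k : ℕ} (c : V → Fin k) : Sym2 V → Bool :=
  Sym2.lift ⟨fun u v => decide (c u = c v), fun u v => by simp [eq_comm]⟩

/-- The edges of the complete graph on `V`: all non-diagonal unordered pairs. -/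
def edgeSet (V : Type*) [Fintype V] [DecidableEq V] : Finset (Sym2 V) :=
  Finset.univ.filter fun e => ¬ e.IsDiag

/-- number of edges agreeing with the clustering `c` under labeling `L`
(`true` = `+`, `false` = `-`). -/
def agreeCount {V : Type*} [Fintype V] [DecidableEq V] {k : ℕ}
    (L : Sym2 V → Bool) (c : V → Fin k) : ℕ :=
  ((edgeSet V).filter fun e => sameBlock c e = L e).card

/-- number of edges disagreeing with the clustering `c`. -/
def disagreeCount {V : Type*} [Fintype V] [DecidableEq V] {k : ℕ}
    (L : Sym2 V → Bool) (c : V → Fin k) : ℕ :=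
  ((edgeSet V).filter fun e => sameBlock c e ≠ L e).card

/-- `val^c(u)`: the fraction of the `n-1` edges incident to `u` agreeing with `c`. -/
noncomputable def valAt {V : Type*} [Fintype V] [DecidableEq V] {k : ℕ}
    (L : Sym2 V → Bool) (c : V → Fin k) (u : V) : ℝ :=
  (((edgeSet V).filter fun e => u ∈ e ∧ sameBlock c e = L e).card : ℝ)
    / ((Fintype.card V : ℝ) - 1)

/-- `pval^c(u,i)`: fraction of edges incident to `u` agreeing with `c^{(u,i)}`. -/
noncomputable def pval {V : Type*} [Fintype V] [DecidableEq V] {k : ℕ}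
    (L : Sym2 V → Bool) (c : V → Fin k) (u : V) (i : Fin k) : ℝ :=
  valAt L (Function.update c u i) u

/-- number of edges labeled . -/
def posCount {V : Type*} [Fintype V] [DecidableEq V] (L : Sym2 V → Bool) : ℕ :=
  ((edgeSet V).filter fun e => L e = true).card

/-- number of edges labeled . -/
def negCount {V : Type*} [Fintype V] [DecidableEq V] (L : Sym2 V → Bool) : ℕ :=
  ((edgeSet V).filter fun e => L e = false).card

/-- A fixed pair of distinct vertices shares a block in a `1 / k` fraction of all `k`-clusterings. -/
theorem card_filter_apply_eq_mul {V : Type*} [Fintype V] [DecidableEq V] {k : ℕ} {u v : V}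
    (huv : u ≠ v) :
    (univ.filter fun c : V → Fin k => c u = c v).card * k = Fintype.card (V → Fin k) := by
  have h : ((univ.filter fun c : V → Fin k => c u = c v) ×ˢ (univ : Finset (Fin k))).card
      = (univ : Finset (V → Fin k)).card := by
    refine Finset.card_nbij' (fun p => Function.update p.1 u p.2)
      (fun d => (Function.update d u (d v), d u)) ?_ ?_ ?_ ?_
    · intro p _
      simp
    · intro d _
      simp [huv.symm]
    · rintro ⟨c, i⟩ hc
      have hc' : c u = c v := by simpa using hc
      simp [huv.symm, ← hc']
    · intro d _
      simp
  simpa using h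

theorem card_filter_sameBlock_eq_false {V : Type*} [Fintype V] [DecidableEq V] {k : ℕ}
    (hk : k ≠ 0) {e : Sym2 V} (he : ¬ e.IsDiag) :
    ((univ.filter fun c : V → Fin k => sameBlock c e = false).card : ℝ)
      = (1 - 1 / (k : ℝ)) * Fintype.card (V → Fin k) := by
  induction e using Sym2.ind with
  | _ u v =>
    have huv : u ≠ v := by simpa using he
    have hsame : ((univ.filter fun c : V → Fin k => c u = c v).card : ℝ) * k
        = Fintype.card (V → Fin k) := by
      exact_mod_cast card_filter_apply_eq_mul (k := k) huv
    have hsplit : ((univ.filter fun c : V → Fin k => c u = c v).card : ℝ)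
        + (univ.filter fun c : V → Fin k => ¬ c u = c v).card = Fintype.card (V → Fin k) := by
      exact_mod_cast Finset.card_filter_add_card_filter_not (s := univ)
        (fun c : V → Fin k => c u = c v)
    have hk' : (k : ℝ) ≠ 0 := by exact_mod_cast hk
    have heq : (univ.filter fun c : V → Fin k => sameBlock c s(u, v) = false)
        = univ.filter fun c : V → Fin k => ¬ c u = c v := by
      ext c
      simp [sameBlock]
    rw [heq, eq_sub_of_add_eq' hsplit, ← hsame]
    field_simp

/-- Averaging over all clusterings yields one separating a `1 - 1 / k` fraction of the
negative edges. -/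
theorem exists_mul_negCount_le_agreeCount {V : Type*} [Fintype V] [DecidableEq V]
    (L : Sym2 V → Bool) {k : ℕ} (hk : k ≠ 0) :
    ∃ c : V → Fin k, (1 - 1 / (k : ℝ)) * (negCount L : ℝ) ≤ (agreeCount L c : ℝ) := by
  have : NeZero k := ⟨hk⟩
  set N := (edgeSet V).filter fun e => L e = false with hN
  have hsum : ∑ c : V → Fin k, (1 - 1 / (k : ℝ)) * (negCount L : ℝ)
      = ∑ c : V → Fin k, ((N.filter fun e => sameBlock c e = false).card : ℝ) := by
    have hswap := Finset.sum_card_bipartiteAbove_eq_sum_card_bipartiteBelow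
      (s := (univ : Finset (V → Fin k))) (t := N) (fun c e => sameBlock c e = false)
    simp only [Finset.bipartiteAbove, Finset.bipartiteBelow] at hswap
    rw [← Nat.cast_sum, hswap, Nat.cast_sum, Finset.sum_congr rfl fun e he =>
      card_filter_sameBlock_eq_false hk (by simp [hN, edgeSet] at he; exact he.1)]
    simp only [Finset.sum_const, nsmul_eq_mul, Finset.card_univ, negCount, ← hN]
    ring
  obtain ⟨c, -, hc⟩ := Finset.exists_le_of_sum_le Finset.univ_nonempty hsum.le
  refine ⟨c, hc.trans ?_⟩
  unfold agreeCount
  gcongr ((?_ : ℕ) : ℝ)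
  refine Finset.card_le_card fun e he => ?_
  simp only [hN, Finset.mem_filter] at he ⊢
  exact ⟨he.1.1, he.2.trans he.1.2.symm⟩

theorem posCount_le_agreeCount_const {V : Type*} [Fintype V] [DecidableEq V]
    (L : Sym2 V → Bool) {k : ℕ} (i : Fin k) :
    posCount L ≤ agreeCount L fun _ => i := by
  refine Finset.card_le_card fun e he => ?_
  simp only [Finset.mem_filter] at he ⊢
  refine ⟨he.1, ?_⟩
  rw [he.2]
  induction e using Sym2.ind with
  | _ u v => simp [sameBlock]

/-- for every sign labeling and every k ≥ 2 there is a k-clustering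
with at least max(n₊, (1 - 1/k)·n₋) agreements. -/
theorem stmt_0 {V : Type*} [Fintype V] [DecidableEq V]
    (L : Sym2 V → Bool) (k : ℕ) (hk : 2 ≤ k) :
    ∃ c : V → Fin k,
      max ((posCount L : ℝ)) ((1 - 1 / (k : ℝ)) * (negCount L : ℝ))
        ≤ (agreeCount L c : ℝ) := by
  obtain ⟨c, hc⟩ := exists_mul_negCount_le_agreeCount L (k := k) (by omega)
  have hpos := posCount_le_agreeCount_const L (⟨0, by omega⟩ : Fin k)
  rcases le_total (posCount L : ℝ) ((1 - 1 / (k : ℝ)) * (negCount L : ℝ)) with h | h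
  · exact ⟨c, max_le (h.trans hc) hc⟩
  · have hpos' : (posCount L : ℝ) ≤ agreeCount L fun _ => (⟨0, by omega⟩ : Fin k) := by
      exact_mod_cast hpos
    exact ⟨_, max_le hpos' (h.trans hpos')⟩
end

section
/- For every sign labeling of the complete graph on a finite vertex set V of size n ≥ 2 and every integer k ≥ 2, there exists a k-clustering c of V with agree(c) ≥ n²/16. -/
open Finset

/-- Flipping the colour of one endpoint of a non-diagonal edge swaps agreement and disagreement, so
each sign is agreed with by exactly half of the two-colourings. -/
theorem two_mul_card_sameBlock_comp {V : Type*} [Fintype V] [DecidableEq V] {k : ℕ}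
    {f : Bool → Fin k} (hf : Function.Injective f) {e : Sym2 V} (he : ¬ e.IsDiag) (s : Bool) :
    2 * (univ.filter fun b : V → Bool => sameBlock (f ∘ b) e = s).card
      = Fintype.card (V → Bool) := by
  induction e using Sym2.ind with
  | _ u v =>
    have huv : v ≠ u := fun h => he (by simp [h])
    let flip : (V → Bool) → (V → Bool) := fun b => Function.update b u (!b u)
    have flip_flip : ∀ b, flip (flip b) = b := fun b => by simp [flip]
    have block_flip : ∀ b, sameBlock (f ∘ flip b) s(u, v) = !sameBlock (f ∘ b) s(u, v) := by
      intro b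
      simp only [sameBlock, Sym2.lift_mk, flip, Function.comp_apply, Function.update_self,
        Function.update_of_ne huv, hf.eq_iff]
      cases b u <;> cases b v <;> rfl
    have hcard : (univ.filter fun b : V → Bool => sameBlock (f ∘ b) s(u, v) = s).card
        = (univ.filter fun b : V → Bool => ¬ sameBlock (f ∘ b) s(u, v) = s).card := by
      refine card_bij' (fun b _ => flip b) (fun b _ => flip b) ?_ ?_
        (fun b _ => flip_flip b) (fun b _ => flip_flip b)
      · intro b hb
        simp only [mem_filter, mem_univ, true_and] at hb ⊢
        simp [block_flip, hb]
      · intro b hb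
        simp only [mem_filter, mem_univ, true_and] at hb ⊢
        rw [block_flip]
        revert hb
        cases sameBlock (f ∘ b) s(u, v) <;> cases s <;> simp
    have hsum := card_filter_add_card_filter_not (s := (univ : Finset (V → Bool)))
      (fun b => sameBlock (f ∘ b) s(u, v) = s)
    rw [card_univ] at hsum
    omega

theorem card_edgeSet (V : Type*) [Fintype V] [DecidableEq V] :
    (edgeSet V).card = (Fintype.card V).choose 2 := by
  rw [← Sym2.card_subtype_not_diag, Fintype.card_subtype, edgeSet]

/-- Some two-colouring agrees with at least half of the edges. -/
theorem exists_card_edgeSet_le_two_mul_agreeCount {V : Type*} [Fintype V] [DecidableEq V]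
    (L : Sym2 V → Bool) {k : ℕ} {f : Bool → Fin k} (hf : Function.Injective f) :
    ∃ b : V → Bool, (edgeSet V).card ≤ 2 * agreeCount L (f ∘ b) := by
  have hsum : ∑ _b : V → Bool, (edgeSet V).card = ∑ b : V → Bool, 2 * agreeCount L (f ∘ b) := by
    simp only [agreeCount, card_filter]
    rw [← mul_sum, sum_comm, mul_sum, sum_const, card_univ, smul_eq_mul, mul_comm,
      ← smul_eq_mul, ← sum_const]
    refine sum_congr rfl fun e he => ?_
    rw [← card_filter, two_mul_card_sameBlock_comp hf (mem_filter.mp he).2]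
  obtain ⟨b, -, hb⟩ := exists_le_of_sum_le univ_nonempty hsum.le
  exact ⟨b, hb⟩

/-- for every sign labeling of the complete graph on n ≥ 2 vertices and
every k ≥ 2 there is a k-clustering with at least n²/16 agreements. -/
theorem stmt_1 {V : Type*} [Fintype V] [DecidableEq V]
    (L : Sym2 V → Bool) (hn : 2 ≤ Fintype.card V) (k : ℕ) (hk : 2 ≤ k) :
    ∃ c : V → Fin k,
      ((Fintype.card V : ℝ)) ^ 2 / 16 ≤ (agreeCount L c : ℝ) := by
  let f : Bool → Fin k := fun b => if b then ⟨1, hk⟩ else ⟨0, by omega⟩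
  have hf : Function.Injective f := by
    intro a b h
    cases a <;> cases b <;> simp_all [f]
  obtain ⟨b, hb⟩ := exists_card_edgeSet_le_two_mul_agreeCount L hf
  refine ⟨f ∘ b, ?_⟩
  rw [card_edgeSet] at hb
  have hb' : (((Fintype.card V).choose 2 : ℕ) : ℝ) ≤ 2 * agreeCount L (f ∘ b) := by
    exact_mod_cast hb
  rw [Nat.cast_choose_two] at hb'
  have hn' : (2 : ℝ) ≤ Fintype.card V := by exact_mod_cast hn
  nlinarith
end

section
/- Let c be a k-clustering of a sign-labeled complete graph on a vertex set V of size n ≥ 2, let u ∈ V, and let i ≠ j be two cluster indices. Then every vertex w ∈ (c⁻¹(i) ∪ c⁻¹(j)) \ {u} has the property that the edge {u,w} agrees with exactly one of the two clusterings c^{(u,i)} and c^{(u,j)}. Consequently, the number of edges incident to u agreeing with c^{(u,i)} plus the number of edges incident to u agreeing with c^{(u,j)} is at most 2(n−1) − |(c⁻¹(i) ∪ c⁻¹(j)) \ {u}|, and hence pval^c(u,i) + pval^c(u,j) ≤ 2 − (|c⁻¹(i)| + |c⁻¹(j)| − 1)/(n−1). -/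
open Finset

/-- Edges incident to `u` satisfying `P` correspond to vertices `w ≠ u` with `P s(u, w)`. -/
lemma card_incident_filter {V : Type*} [Fintype V] [DecidableEq V] (u : V)
    (P : Sym2 V → Prop) [DecidablePred P] :
    ((edgeSet V).filter fun e => u ∈ e ∧ P e).card
      = (Finset.univ.filter fun w => w ≠ u ∧ P s(u, w)).card := by
  symm
  refine Finset.card_bij (fun w _ => s(u, w)) ?_ ?_ ?_
  · intro w hw
    simp only [mem_filter, mem_univ, true_and] at hw
    simp [edgeSet, hw.1.symm, hw.2]
  · intro a _ b _ hab
    exact Sym2.congr_right.mp hab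
  · intro e he
    simp only [edgeSet, mem_filter, mem_univ, true_and] at he
    obtain ⟨hd, ⟨w, rfl⟩, hP⟩ := he
    exact ⟨w, by simpa [hP, eq_comm] using hd, rfl⟩

/-- Moving `u` to cluster `i` puts `w ≠ u` in the same block as `u` iff `w` is in cluster `i`. -/
lemma sameBlock_update {V : Type*} [DecidableEq V] {k : ℕ} (c : V → Fin k) {u w : V}
    (hw : w ≠ u) (i : Fin k) :
    sameBlock (Function.update c u i) s(u, w) = decide (i = c w) := by
  simp [sameBlock, hw]

/-- If exactly one of two vertex predicates holds on every vertex of a set avoiding `u`, then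
the two counts away from `u` are bounded by twice the number of such vertices minus the size
of the set. -/
lemma card_filter_add_card_filter_add_card_le {V : Type*} [Fintype V] [DecidableEq V] (u : V)
    (P Q R : V → Prop) [DecidablePred P] [DecidablePred Q] [DecidablePred R]
    (h : ∀ w, w ≠ u → R w → Xor (P w) (Q w)) :
    (Finset.univ.filter fun w => w ≠ u ∧ P w).card
      + (Finset.univ.filter fun w => w ≠ u ∧ Q w).card
      + (Finset.univ.filter fun w => w ≠ u ∧ R w).card ≤ 2 * (Fintype.card V - 1) := by
  set A := Finset.univ.filter fun w => w ≠ u ∧ P w with hA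
  set B := Finset.univ.filter fun w => w ≠ u ∧ Q w with hB
  set S := Finset.univ.filter fun w => w ≠ u ∧ R w with hS
  have hcard : (Finset.univ.erase u).card = Fintype.card V - 1 := by
    rw [Finset.card_erase_of_mem (mem_univ u), Finset.card_univ]
  have hunion : (A ∪ B).card ≤ Fintype.card V - 1 := by
    rw [← hcard]
    refine Finset.card_le_card fun w hw => ?_
    simp only [hA, hB, mem_union, mem_filter, mem_univ, true_and] at hw
    simp only [mem_erase, mem_univ, and_true]
    tauto
  have hdisj : Disjoint (A ∩ B) S := by
    rw [Finset.disjoint_left]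
    intro w hw hwS
    simp only [hA, hB, mem_inter, mem_filter, mem_univ, true_and] at hw
    simp only [hS, mem_filter, mem_univ, true_and] at hwS
    rcases h w hwS.1 hwS.2 with hx | hx
    · exact hx.2 hw.2.2
    · exact hx.2 hw.1.2
  have hinter : (A ∩ B).card + S.card ≤ Fintype.card V - 1 := by
    rw [← hcard, ← Finset.card_union_of_disjoint hdisj]
    refine Finset.card_le_card fun w hw => ?_
    simp only [hA, hB, hS, mem_union, mem_inter, mem_filter, mem_univ, true_and] at hw
    simp only [mem_erase, mem_univ, and_true]
    tauto
  have := Finset.card_union_add_card_inter A B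
  omega

/-- Two distinct fibres have, up to the vertex `u`, the size of their union away from `u`. -/
lemma card_fibers_le {V α : Type*} [Fintype V] [DecidableEq V] [DecidableEq α] (c : V → α)
    (u : V) {i j : α} (hij : i ≠ j) :
    (Finset.univ.filter fun w => c w = i).card + (Finset.univ.filter fun w => c w = j).card
      ≤ (Finset.univ.filter fun w => w ≠ u ∧ (c w = i ∨ c w = j)).card + 1 := by
  have hdisj : Disjoint (Finset.univ.filter fun w => c w = i)
      (Finset.univ.filter fun w => c w = j) := by
    rw [Finset.disjoint_filter]
    rintro w _ rfl
    exact hij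
  rw [← Finset.card_union_of_disjoint hdisj]
  refine le_trans (Finset.card_le_card fun w hw => ?_) (Finset.card_insert_le u _)
  simp only [mem_union, mem_filter, mem_univ, true_and] at hw
  simp only [mem_insert, mem_filter, mem_univ, true_and]
  tauto

/-- for a clustering c, a vertex u and distinct cluster indices i, j:
every vertex w in (c⁻¹(i) ∪ c⁻¹(j)) \ {u} has the edge {u,w} agreeing with exactly one
of c^(u,i), c^(u,j); hence the two incident agreement counts sum to at most
2(n-1) - |(c⁻¹(i) ∪ c⁻¹(j)) \ {u}|, and pval^c(u,i) + pval^c(u,j)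
≤ 2 - (|c⁻¹(i)| + |c⁻¹(j)| - 1)/(n-1). -/
theorem stmt_3 {V : Type*} [Fintype V] [DecidableEq V]
    (L : Sym2 V → Bool) {k : ℕ} (c : V → Fin k) (u : V) (i j : Fin k)
    (hn : 2 ≤ Fintype.card V) (hij : i ≠ j) :
    (∀ w : V, w ≠ u → (c w = i ∨ c w = j) →
        Xor' (sameBlock (Function.update c u i) s(u, w) = L s(u, w))
             (sameBlock (Function.update c u j) s(u, w) = L s(u, w)))
    ∧ ((((edgeSet V).filter fun e =>
            u ∈ e ∧ sameBlock (Function.update c u i) e = L e).card : ℝ)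
        + (((edgeSet V).filter fun e =>
            u ∈ e ∧ sameBlock (Function.update c u j) e = L e).card : ℝ)
        ≤ 2 * ((Fintype.card V : ℝ) - 1)
          - ((Finset.univ.filter fun w => w ≠ u ∧ (c w = i ∨ c w = j)).card : ℝ))
    ∧ (pval L c u i + pval L c u j
        ≤ 2 - (((Finset.univ.filter fun w => c w = i).card : ℝ)
                + ((Finset.univ.filter fun w => c w = j).card : ℝ) - 1)
              / ((Fintype.card V : ℝ) - 1)) := by
  have hxor : ∀ w : V, w ≠ u → (c w = i ∨ c w = j) →
      Xor (sameBlock (Function.update c u i) s(u, w) = L s(u, w))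
        (sameBlock (Function.update c u j) s(u, w) = L s(u, w)) := by
    intro w hw hc
    rw [sameBlock_update c hw, sameBlock_update c hw]
    rcases hc with hc | hc <;> cases L s(u, w) <;> simp [Xor, hc, hij, hij.symm]
  have hcount := card_filter_add_card_filter_add_card_le u _ _ _ hxor
  rw [← card_incident_filter u fun e => sameBlock (Function.update c u i) e = L e,
    ← card_incident_filter u fun e => sameBlock (Function.update c u j) e = L e] at hcount
  have hcountR := (Nat.cast_le (α := ℝ)).mpr hcount
  push_cast [Nat.cast_sub (show 1 ≤ Fintype.card V by omega)] at hcountR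
  have hfib := (Nat.cast_le (α := ℝ)).mpr (card_fibers_le c u hij)
  push_cast at hfib
  refine ⟨hxor, by linarith, ?_⟩
  have hpos : (0 : ℝ) < (Fintype.card V : ℝ) - 1 := by
    have : (2 : ℝ) ≤ Fintype.card V := by exact_mod_cast hn
    linarith
  rw [pval, pval, valAt, valAt, ← add_div, le_sub_iff_add_le, ← add_div, div_le_iff₀ hpos]
  linarith
end

section
/- Let c be a k-clustering of a sign-labeled complete graph on a vertex set V of size n ≥ 2, let k ≥ 2, and let c₁ > 0. Define T_low := {u ∈ V : val^c(u) ≤ 1 − c₁/k²}. Then |T_low| ≤ 2k²·disagr(c)/((n−1)·c₁). -/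
open Finset

theorem filter_mem_edgeSet {V : Type*} [Fintype V] [DecidableEq V] (u : V) :
    (edgeSet V).filter (fun e => u ∈ e) = (univ.erase u).image fun v => s(u, v) := by
  ext e
  induction e with
  | h a b =>
    simp only [edgeSet, mem_filter, mem_univ, true_and, mem_image, mem_erase, and_true,
      Sym2.mem_iff, Sym2.eq_iff, Sym2.mk_isDiag_iff]
    constructor
    · rintro ⟨h, rfl | rfl⟩
      · exact ⟨b, Ne.symm h, Or.inl ⟨rfl, rfl⟩⟩
      · exact ⟨a, h, Or.inr ⟨rfl, rfl⟩⟩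
    · rintro ⟨v, hv, ⟨rfl, rfl⟩ | ⟨rfl, rfl⟩⟩
      · exact ⟨hv.symm, Or.inl rfl⟩
      · exact ⟨hv, Or.inr rfl⟩

theorem card_filter_mem_edgeSet {V : Type*} [Fintype V] [DecidableEq V] (u : V) :
    ((edgeSet V).filter fun e => u ∈ e).card = Fintype.card V - 1 := by
  rw [filter_mem_edgeSet, card_image_of_injective _ fun a b h => Sym2.congr_right.mp h,
    card_erase_of_mem (mem_univ u), card_univ]

/-- Handshake identity for a set of non-diagonal unordered pairs. -/
theorem sum_card_filter_mem_eq {V : Type*} [Fintype V] [DecidableEq V]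
    (D : Finset (Sym2 V)) (hD : ∀ e ∈ D, ¬ e.IsDiag) :
    ∑ u : V, (D.filter fun e => u ∈ e).card = 2 * D.card := by
  have h := sum_card_bipartiteAbove_eq_sum_card_bipartiteBelow
    (s := (univ : Finset V)) (t := D) (fun u e => u ∈ e)
  simp only [bipartiteAbove, bipartiteBelow] at h
  rw [h, sum_const_nat (m := 2), mul_comm]
  intro e he
  rw [← Sym2.card_toFinset_of_not_isDiag e (hD e he)]
  congr 1
  ext u
  simp

/-- the set of low-value nodes T_low = {u : val^c(u) ≤ 1 - c₁/k²}
has size at most 2k²·disagr(c)/((n-1)·c₁). -/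
theorem stmt_5 {V : Type*} [Fintype V] [DecidableEq V]
    (L : Sym2 V → Bool) {k : ℕ} (c : V → Fin k)
    (hn : 2 ≤ Fintype.card V) (hk : 2 ≤ k) (c₁ : ℝ) (hc₁ : 0 < c₁) :
    ((Finset.univ.filter fun u => valAt L c u ≤ 1 - c₁ / (k : ℝ) ^ 2).card : ℝ)
      ≤ 2 * (k : ℝ) ^ 2 * (disagreeCount L c : ℝ)
          / (((Fintype.card V : ℝ) - 1) * c₁) := by
  set D := (edgeSet V).filter fun e => sameBlock c e ≠ L e with hD
  set T := Finset.univ.filter fun u => valAt L c u ≤ 1 - c₁ / (k : ℝ) ^ 2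
  have hn' : (0 : ℝ) < (Fintype.card V : ℝ) - 1 := by
    have : (2 : ℝ) ≤ Fintype.card V := by exact_mod_cast hn
    linarith
  have hk' : (0 : ℝ) < (k : ℝ) ^ 2 := by positivity
  have hlow : ∀ u ∈ T, ((Fintype.card V : ℝ) - 1) * (c₁ / (k : ℝ) ^ 2)
      ≤ ((D.filter fun e => u ∈ e).card : ℝ) := by
    intro u hu
    have hval := (mem_filter.mp hu).2
    rw [valAt, div_le_iff₀ hn'] at hval
    have hsplit := card_filter_add_card_filter_not
      (s := (edgeSet V).filter fun e => u ∈ e) (fun e => sameBlock c e = L e)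
    rw [card_filter_mem_edgeSet, filter_filter, filter_filter] at hsplit
    have hcomm : D.filter (fun e => u ∈ e)
        = (edgeSet V).filter fun e => u ∈ e ∧ ¬ sameBlock c e = L e := by
      rw [hD, filter_filter]
      exact filter_congr fun e _ => and_comm
    rw [← hcomm] at hsplit
    have hcast := congrArg (Nat.cast (R := ℝ)) hsplit
    rw [Nat.cast_add, Nat.cast_sub (by omega), Nat.cast_one] at hcast
    linarith
  have hsum : ∑ u : V, ((D.filter fun e => u ∈ e).card : ℝ) = 2 * (disagreeCount L c : ℝ) := by
    exact_mod_cast sum_card_filter_mem_eq D fun e he =>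
      (mem_filter.mp (mem_filter.mp he).1).2
  have hbound : (T.card : ℝ) * (((Fintype.card V : ℝ) - 1) * (c₁ / (k : ℝ) ^ 2))
      ≤ 2 * (disagreeCount L c : ℝ) := by
    rw [← hsum, ← nsmul_eq_mul]
    exact (card_nsmul_le_sum T _ _ hlow).trans
      (sum_le_sum_of_subset_of_nonneg (subset_univ T) fun _ _ _ => Nat.cast_nonneg _)
  rw [le_div_iff₀ (by positivity)]
  calc (T.card : ℝ) * (((Fintype.card V : ℝ) - 1) * c₁)
      = (k : ℝ) ^ 2 * ((T.card : ℝ) * (((Fintype.card V : ℝ) - 1) * (c₁ / (k : ℝ) ^ 2))) := by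
        field_simp
    _ ≤ (k : ℝ) ^ 2 * (2 * (disagreeCount L c : ℝ)) := by gcongr
    _ = 2 * (k : ℝ) ^ 2 * (disagreeCount L c : ℝ) := by ring
end

section
/- Let D be a k-clustering of a sign-labeled complete graph on a vertex set V of size n ≥ 2, let c₁ > 0 and β ≥ 0, let u ∈ V with D(u) = j, and let i ≠ j. If val^D(u) ≥ 1 − c₁/k² and pval^D(u,i) ≥ val^D(u) − 2β, then |D⁻¹(i)| ≤ 2(c₁/k² + β)·n + 1 and |D⁻¹(j)| ≤ 2(c₁/k² + β)·n + 1. -/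
open Finset

theorem card_filter_incident_agree {V : Type*} [Fintype V] [DecidableEq V] {k : ℕ}
    (L : Sym2 V → Bool) (c : V → Fin k) (u : V) :
    ((edgeSet V).filter fun e => u ∈ e ∧ sameBlock c e = L e).card
      = ((Finset.univ.erase u).filter fun x => decide (c u = c x) = L s(u, x)).card := by
  symm
  refine Finset.card_bij (fun x _ => s(u, x)) ?_ ?_ ?_
  · intro x hx
    simp only [Finset.mem_filter, Finset.mem_erase, Finset.mem_univ, and_true] at hx
    simpa [edgeSet, sameBlock, eq_comm] using hx
  · intro x _ y _ h
    exact Sym2.congr_right.mp h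
  · intro e he
    simp only [edgeSet, Finset.mem_filter, Finset.mem_univ, true_and] at he
    obtain ⟨hd, ⟨x, rfl⟩, h⟩ := he
    refine ⟨x, ?_, rfl⟩
    simp only [Finset.mem_filter, Finset.mem_erase, Finset.mem_univ, and_true]
    exact ⟨fun hx => hd (by simp [hx]), h⟩

theorem card_agree_add_card_agree_update_le {V : Type*} [Fintype V] [DecidableEq V] {k : ℕ}
    (L : Sym2 V → Bool) (c : V → Fin k) (u : V) (i : Fin k) (hi : i ≠ c u) :
    ((edgeSet V).filter fun e => u ∈ e ∧ sameBlock c e = L e).card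
      + ((edgeSet V).filter fun e => u ∈ e ∧ sameBlock (Function.update c u i) e = L e).card
      + (Finset.univ.filter fun x => c x = i).card
      + (Finset.univ.filter fun x => c x = c u).card
      ≤ 2 * (Fintype.card V - 1) + 1 := by
  have hI : (Finset.univ.filter fun x => c x = i)
      = (Finset.univ.erase u).filter fun x => c x = i := by
    ext x
    simp only [Finset.mem_filter, Finset.mem_erase, Finset.mem_univ, and_true, true_and]
    exact ⟨fun h => ⟨fun hx => hi (by rw [← h, hx]), h⟩, And.right⟩
  have hJ : (Finset.univ.filter fun x => c x = c u)
      = insert u ((Finset.univ.erase u).filter fun x => c x = c u) := by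
    ext x
    by_cases hx : x = u <;> simp [hx]
  rw [card_filter_incident_agree, card_filter_incident_agree, hI, hJ,
    Finset.card_insert_of_notMem (by simp), ← add_assoc]
  have hcard : Fintype.card V - 1 = (Finset.univ.erase u).card := by
    rw [Finset.card_erase_of_mem (Finset.mem_univ u), Finset.card_univ]
  rw [hcard, mul_comm, ← smul_eq_mul, ← Finset.sum_const]
  simp only [Finset.card_filter, ← Finset.sum_add_distrib]
  refine Nat.add_le_add_right (Finset.sum_le_sum fun x hx => ?_) 1
  rw [Function.update_self, Function.update_of_ne (Finset.ne_of_mem_erase hx)]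
  cases L s(u, x) <;> simp only [decide_eq_true_eq, decide_eq_false_iff_not] <;> grind

/-- if u lies in cluster j of D, val^D(u) ≥ 1 - c₁/k² and
pval^D(u,i) ≥ val^D(u) - 2β for some i ≠ j, then both clusters i and j of D
have size at most 2(c₁/k² + β)n + 1. -/
theorem stmt_7 {V : Type*} [Fintype V] [DecidableEq V]
    (L : Sym2 V → Bool) {k : ℕ} (D : V → Fin k)
    (hn : 2 ≤ Fintype.card V)
    (c₁ β : ℝ) (hc₁ : 0 < c₁) (hβ : 0 ≤ β)
    (u : V) (i j : Fin k) (hj : D u = j) (hij : i ≠ j)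
    (hval : 1 - c₁ / (k : ℝ) ^ 2 ≤ valAt L D u)
    (hpval : valAt L D u - 2 * β ≤ pval L D u i) :
    ((Finset.univ.filter fun x => D x = i).card : ℝ)
        ≤ 2 * (c₁ / (k : ℝ) ^ 2 + β) * (Fintype.card V : ℝ) + 1
    ∧ ((Finset.univ.filter fun x => D x = j).card : ℝ)
        ≤ 2 * (c₁ / (k : ℝ) ^ 2 + β) * (Fintype.card V : ℝ) + 1 := by
  subst hj
  have hcount := card_agree_add_card_agree_update_le L D u i hij
  unfold pval at hpval
  unfold valAt at hval hpval
  generalize ((edgeSet V).filter fun e => u ∈ e ∧ sameBlock D e = L e).card = a at *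
  generalize ((edgeSet V).filter fun e =>
    u ∈ e ∧ sameBlock (Function.update D u i) e = L e).card = b at *
  generalize (Finset.univ.filter fun x => D x = i).card = p at *
  have hq : 1 ≤ (Finset.univ.filter fun x => D x = D u).card :=
    Finset.card_pos.mpr ⟨u, by simp⟩
  generalize (Finset.univ.filter fun x => D x = D u).card = q at *
  have hε : 0 ≤ c₁ / (k : ℝ) ^ 2 := by positivity
  generalize c₁ / (k : ℝ) ^ 2 = ε at *
  obtain ⟨m, hm⟩ : ∃ m, Fintype.card V = m + 1 := ⟨Fintype.card V - 1, by omega⟩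
  rw [hm] at hcount hval hpval hn ⊢
  have hm0 : (0 : ℝ) < m := by exact_mod_cast (by omega : 0 < m)
  have hcount' : (a : ℝ) + b + p + q ≤ 2 * m + 1 := by exact_mod_cast hcount
  push_cast at hval hpval ⊢
  rw [add_sub_cancel_right] at hval hpval
  have ha : (1 - ε) * m ≤ a := (le_div_iff₀ hm0).mp hval
  have hb : (1 - ε - 2 * β) * m ≤ b := (le_div_iff₀ hm0).mp (by linarith)
  have hq' : (1 : ℝ) ≤ q := by exact_mod_cast hq
  have hp' : (0 : ℝ) ≤ p := p.cast_nonneg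
  constructor <;> nlinarith
end

section
/- Set c₁ = 1/20. Let k ≥ 2, let the vertex set V have size n with n ≥ 100·k³, and let D be a k-clustering of a sign-labeled complete graph on V with disagr(D) = γ·n² where γ ≤ c₁/(16k³). Let 0 ≤ β ≤ c₁/(16k²) and let C : V → {1,…,k} be any k-clustering such that for every u ∈ V, pval^D(u, C(u)) ≥ val^D(u) − 2β. Then there exists a k-clustering F of V such that (i) F⁻¹(i) = C⁻¹(i) for every cluster index i with |C⁻¹(i)| ≥ n/(2k), and (ii) disagr(F) ≤ γ·n²·(1 + (4k²/c₁)·(β + 2k²γ/c₁)). -/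
open Finset

/-- Indicator that the pair `u`, `v` is an edge disagreeing with `c`. -/
def disagreeInd {V : Type*} [DecidableEq V] {k : ℕ} (L : Sym2 V → Bool) (c : V → Fin k)
    (u v : V) : ℝ :=
  if u ≠ v ∧ sameBlock c s(u, v) ≠ L s(u, v) then 1 else 0

theorem disagreeInd_nonneg {V : Type*} [DecidableEq V] {k : ℕ} (L : Sym2 V → Bool)
    (c : V → Fin k) (u v : V) : 0 ≤ disagreeInd L c u v := by
  unfold disagreeInd; split_ifs <;> norm_num

theorem disagreeInd_le_one {V : Type*} [DecidableEq V] {k : ℕ} (L : Sym2 V → Bool)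
    (c : V → Fin k) (u v : V) : disagreeInd L c u v ≤ 1 := by
  unfold disagreeInd; split_ifs <;> norm_num

theorem disagreeInd_comm {V : Type*} [DecidableEq V] {k : ℕ} (L : Sym2 V → Bool)
    (c : V → Fin k) (u v : V) : disagreeInd L c u v = disagreeInd L c v u := by
  simp only [disagreeInd, Sym2.eq_swap (a := u) (b := v), ne_comm (a := u) (b := v)]

theorem disagreeInd_congr {V : Type*} [DecidableEq V] {k : ℕ} (L : Sym2 V → Bool)
    {c c' : V → Fin k} {u v : V} (h : u ≠ v → c u = c' u ∧ c v = c' v) :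
    disagreeInd L c u v = disagreeInd L c' u v := by
  unfold disagreeInd
  by_cases huv : u = v
  · simp [huv]
  · have hs : sameBlock c s(u, v) = sameBlock c' s(u, v) := by simp [sameBlock, h huv]
    simp only [hs]

theorem sum_sum_disagreeInd {V : Type*} [Fintype V] [DecidableEq V] {k : ℕ}
    (L : Sym2 V → Bool) (c : V → Fin k) :
    ∑ u, ∑ v, disagreeInd L c u v = 2 * (disagreeCount L c : ℝ) := by
  let G : SimpleGraph V :=
    { Adj := fun u v => u ≠ v ∧ sameBlock c s(u, v) ≠ L s(u, v)
      symm := ⟨fun u v h => by rw [Sym2.eq_swap, ne_comm]; exact h⟩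
      loopless := ⟨fun u h => h.1 rfl⟩ }
  have : DecidableRel G.Adj := fun u v =>
    inferInstanceAs (Decidable (u ≠ v ∧ sameBlock c s(u, v) ≠ L s(u, v)))
  have hE : G.edgeFinset = (edgeSet V).filter fun e => sameBlock c e ≠ L e := by
    ext e
    induction e using Sym2.ind with
    | _ u v =>
      rw [SimpleGraph.mem_edgeFinset, SimpleGraph.mem_edgeSet]
      simp [G, edgeSet]
  have hd : ∀ u, ∑ v, disagreeInd L c u v = (G.degree u : ℝ) := by
    intro u
    rw [← SimpleGraph.card_neighborFinset_eq_degree, SimpleGraph.neighborFinset_eq_filter]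
    simp only [disagreeInd, Finset.sum_boole]
    congr!
  have h := G.sum_degrees_eq_twice_card_edges
  rw [hE] at h
  simp only [hd]
  exact_mod_cast h

theorem valAt_mul {V : Type*} [Fintype V] [DecidableEq V] {k : ℕ}
    (L : Sym2 V → Bool) (c : V → Fin k) (u : V) (hV : 1 < Fintype.card V) :
    valAt L c u * ((Fintype.card V : ℝ) - 1)
      = (Fintype.card V : ℝ) - 1 - ∑ v, disagreeInd L c u v := by
  have hV' : (1 : ℝ) < Fintype.card V := by exact_mod_cast hV
  have h1 : ((edgeSet V).filter fun e => u ∈ e ∧ sameBlock c e = L e).card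
      = (Finset.univ.filter fun v => u ≠ v ∧ sameBlock c s(u, v) = L s(u, v)).card := by
    symm
    refine Finset.card_bij (fun v _ => s(u, v)) ?_ ?_ ?_
    · intro v hv
      simpa [edgeSet] using hv
    · intro v _ w _ h
      exact Sym2.congr_right.mp h
    · intro e he
      simp only [edgeSet, Finset.mem_filter, Finset.mem_univ, true_and] at he
      obtain ⟨hdiag, ⟨v, rfl⟩, hL⟩ := he
      exact ⟨v, by simpa using ⟨hdiag, hL⟩, rfl⟩
  have h2 : ((Finset.univ.filter fun v => u ≠ v ∧ sameBlock c s(u, v) = L s(u, v)).card : ℝ)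
      + ∑ v, disagreeInd L c u v + 1 = Fintype.card V := by
    have h3 : (Fintype.card V : ℝ) = ∑ _v : V, (1 : ℝ) := by simp
    have h4 : (1 : ℝ) = ∑ v, if u = v then (1 : ℝ) else 0 := by simp
    rw [← Finset.sum_boole, h3]
    nth_rewrite 2 [h4]
    rw [← Finset.sum_add_distrib, ← Finset.sum_add_distrib]
    refine Finset.sum_congr rfl fun v _ => ?_
    unfold disagreeInd
    by_cases huv : u = v
    · simp [huv]
    · by_cases hL : sameBlock c s(u, v) = L s(u, v) <;> simp [huv, hL]
  unfold valAt
  rw [h1, div_mul_cancel₀ _ (by linarith)]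
  linarith

/-- Moving `u` between two distinct clusters flips every edge from `u` into either of them, so
the sizes of both are bounded by the disagreements at `u` before and after the move. -/
theorem card_cluster_le_of_move {V : Type*} [Fintype V] [DecidableEq V] {k : ℕ}
    (L : Sym2 V → Bool) (D : V → Fin k) (u : V) {i m : Fin k} (hi : i ≠ D u)
    (hm : m = i ∨ m = D u) :
    ((Finset.univ.filter fun v => D v = m).card : ℝ)
      ≤ ∑ v, disagreeInd L D u v + ∑ v, disagreeInd L (Function.update D u i) u v + 1 := by
  have h4 : (1 : ℝ) = ∑ v, if u = v then (1 : ℝ) else 0 := by simp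
  rw [← Finset.sum_boole]
  nth_rewrite 2 [h4]
  rw [← Finset.sum_add_distrib, ← Finset.sum_add_distrib]
  refine Finset.sum_le_sum fun v _ => ?_
  have ha := disagreeInd_nonneg L D u v
  have hb := disagreeInd_nonneg L (Function.update D u i) u v
  by_cases huv : u = v
  · rw [if_pos huv]
    split_ifs <;> linarith
  · rw [if_neg huv]
    split_ifs with hv
    · have hvu : v ≠ u := fun h => huv h.symm
      unfold disagreeInd
      rcases hm with rfl | rfl
      · have hne : D u ≠ D v := fun h => hi (by rw [← hv, h])
        cases L s(u, v) <;> simp [sameBlock, huv, hvu, hv, hi.symm]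
      · cases L s(u, v) <;> simp [sameBlock, huv, hvu, hv, hi]
    · linarith

/-- Reassigning the vertices of `T`, each at a cost of at most `δ` against `D`, costs at most
`δ` per vertex plus the pairs inside `T`. -/
theorem disagreeCount_piecewise_le {V : Type*} [Fintype V] [DecidableEq V] {k : ℕ}
    (L : Sym2 V → Bool) (C D : V → Fin k) (T : Finset V) (δ : ℝ)
    (h : ∀ u ∈ T, ∑ v, disagreeInd L (Function.update D u (C u)) u v
      ≤ ∑ v, disagreeInd L D u v + δ) :
    (disagreeCount L (T.piecewise C D) : ℝ) ≤ disagreeCount L D + T.card * (δ + T.card) := by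
  let f : V → V → ℝ := fun u v =>
    if u ∈ T then disagreeInd L (Function.update D u (C u)) u v - disagreeInd L D u v else 0
  have hpt : ∀ u v, disagreeInd L (T.piecewise C D) u v
      ≤ disagreeInd L D u v + f u v + f v u
        + 2 * ((if u ∈ T then 1 else 0) * (if v ∈ T then 1 else 0)) := by
    intro u v
    simp only [f]
    by_cases hu : u ∈ T <;> by_cases hv : v ∈ T
    · have h1 := disagreeInd_le_one L (T.piecewise C D) u v
      have h2 := disagreeInd_le_one L D u v
      have h3 := disagreeInd_nonneg L (Function.update D u (C u)) u v
      have h4 := disagreeInd_nonneg L (Function.update D v (C v)) v u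
      have h5 := disagreeInd_comm L D u v
      simp only [hu, hv, if_true]
      linarith
    · have h1 : disagreeInd L (T.piecewise C D) u v
          = disagreeInd L (Function.update D u (C u)) u v :=
        disagreeInd_congr L fun huv => by simp [hu, hv, huv.symm]
      simp [hu, hv, h1]
    · have h1 : disagreeInd L (T.piecewise C D) v u
          = disagreeInd L (Function.update D v (C v)) v u :=
        disagreeInd_congr L fun huv => by simp [hu, hv, huv.symm]
      simp [hu, hv, disagreeInd_comm L _ u v, h1]
    · have h1 : disagreeInd L (T.piecewise C D) u v = disagreeInd L D u v :=
        disagreeInd_congr L fun _ => by simp [hu, hv]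
      simp [hu, hv, h1]
  have hf : ∑ u, ∑ v, f u v ≤ T.card * δ := by
    have h1 : ∀ u, ∑ v, f u v ≤ if u ∈ T then δ else 0 := by
      intro u
      by_cases hu : u ∈ T
      · simp only [f, hu, if_true, Finset.sum_sub_distrib]
        linarith [h u hu]
      · simp [f, hu]
    refine (Finset.sum_le_sum fun u _ => h1 u).trans ?_
    simp
  have hf' : ∑ u, ∑ v, f v u ≤ T.card * δ := by
    rw [Finset.sum_comm]; exact hf
  have hT : ∑ u, ((if u ∈ T then (1 : ℝ) else 0) * ∑ v, if v ∈ T then (1 : ℝ) else 0)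
      = T.card * T.card := by
    rw [← Finset.sum_mul]; simp
  have hsum := Finset.sum_le_sum fun u (_ : u ∈ Finset.univ) =>
    Finset.sum_le_sum fun v (_ : v ∈ Finset.univ) => hpt u v
  simp only [Finset.sum_add_distrib, ← Finset.mul_sum] at hsum
  rw [sum_sum_disagreeInd, sum_sum_disagreeInd, hT] at hsum
  linarith

/-- At most `k * s` vertices lie in clusters of size at most `s`. -/
theorem card_small_clusters_le {V : Type*} [Fintype V] [DecidableEq V] {k : ℕ}
    (D : V → Fin k) {s : ℝ} (hs : 0 ≤ s) :
    ((Finset.univ.filter fun v =>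
      ((Finset.univ.filter fun w => D w = D v).card : ℝ) ≤ s).card : ℝ) ≤ k * s := by
  rw [Finset.card_eq_sum_card_fiberwise (f := D) (t := Finset.univ) (by simp)]
  push_cast
  have h : ∀ i ∈ (Finset.univ : Finset (Fin k)),
      (((Finset.univ.filter fun v =>
        ((Finset.univ.filter fun w => D w = D v).card : ℝ) ≤ s).filter
          fun v => D v = i).card : ℝ) ≤ s := by
    intro i _
    by_cases hi : ((Finset.univ.filter fun w => D w = i).card : ℝ) ≤ s
    · refine le_trans ?_ hi
      exact_mod_cast Finset.card_le_card (by intro v; simp)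
    · rw [Finset.filter_eq_empty_iff.mpr]
      · simpa using hs
      · rintro v hv rfl
        exact hi (Finset.mem_filter.mp hv).2
  refine (Finset.sum_le_sum h).trans ?_
  simp

/-- under the same hypotheses as Statement 8, there is a clustering F
agreeing with C on every large cluster of C and with
disagr(F) ≤ γn²(1 + (4k²/c₁)(β + 2k²γ/c₁)). -/
theorem stmt_9 {V : Type*} [Fintype V] [DecidableEq V]
    (L : Sym2 V → Bool) {k : ℕ} (hk : 2 ≤ k)
    (hn : 100 * k ^ 3 ≤ Fintype.card V)
    (c₁ : ℝ) (hc₁ : c₁ = 1 / 20)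
    (D : V → Fin k) (γ β : ℝ)
    (hγ : (disagreeCount L D : ℝ) = γ * (Fintype.card V : ℝ) ^ 2)
    (hγ' : γ ≤ c₁ / (16 * (k : ℝ) ^ 3))
    (hβ0 : 0 ≤ β) (hβ : β ≤ c₁ / (16 * (k : ℝ) ^ 2))
    (C : V → Fin k)
    (hC : ∀ u : V, valAt L D u - 2 * β ≤ pval L D u (C u)) :
    ∃ F : V → Fin k,
      (∀ i : Fin k,
        (Fintype.card V : ℝ) / (2 * (k : ℝ))
            ≤ ((Finset.univ.filter fun x => C x = i).card : ℝ) →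
        (Finset.univ.filter fun x => F x = i)
          = (Finset.univ.filter fun x => C x = i))
      ∧ (disagreeCount L F : ℝ)
          ≤ γ * (Fintype.card V : ℝ) ^ 2
              * (1 + 4 * (k : ℝ) ^ 2 / c₁ * (β + 2 * (k : ℝ) ^ 2 * γ / c₁)) := by
  subst hc₁
  have hk2 : (2 : ℝ) ≤ k := by exact_mod_cast hk
  have hk0 : (0 : ℝ) < k := by linarith
  have hnR : 100 * (k : ℝ) ^ 3 ≤ Fintype.card V := by exact_mod_cast hn
  have hk3 : (8 : ℝ) ≤ (k : ℝ) ^ 3 := by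
    calc (8 : ℝ) = 2 ^ 3 := by norm_num
      _ ≤ (k : ℝ) ^ 3 := by gcongr
  have hV : 1 < Fintype.card V := by
    have : (1 : ℝ) < Fintype.card V := by linarith
    exact_mod_cast this
  set n : ℝ := (Fintype.card V : ℝ) with hn_def
  have hn800 : 800 ≤ n := by linarith
  have hn1 : 0 < n - 1 := by linarith
  have hγ0 : 0 ≤ γ := by
    have h : 0 ≤ γ * n ^ 2 := by rw [← hγ]; positivity
    exact nonneg_of_mul_nonneg_left h (by positivity)
  have hmove : ∀ u, ∑ v, disagreeInd L (Function.update D u (C u)) u v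
      ≤ ∑ v, disagreeInd L D u v + 2 * β * (n - 1) := by
    intro u
    have h1 := valAt_mul L D u hV
    have h2 := valAt_mul L (Function.update D u (C u)) u hV
    have h3 := mul_le_mul_of_nonneg_right (hC u) hn1.le
    unfold pval at h3
    rw [h2, sub_mul, h1] at h3
    linarith
  let t : ℝ := 1 / 20 / (k : ℝ) ^ 2 * (n - 1)
  have ht0 : 0 ≤ t := by positivity
  let T : Finset V := Finset.univ.filter fun u => t < ∑ v, disagreeInd L D u v
  have hTt : T.card * t ≤ 2 * (γ * n ^ 2) := by
    rw [← hγ, ← sum_sum_disagreeInd, ← nsmul_eq_mul]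
    refine (Finset.card_nsmul_le_sum T (fun u => ∑ v, disagreeInd L D u v) t
      fun u hu => (Finset.mem_filter.mp hu).2.le).trans ?_
    exact Finset.sum_le_sum_of_subset_of_nonneg (Finset.subset_univ _)
      fun u _ _ => Finset.sum_nonneg fun v _ => disagreeInd_nonneg L D u v
  have hT : T.card * (n - 1) ≤ 40 * (k : ℝ) ^ 2 * (γ * n ^ 2) := by
    have h : T.card * (n - 1) = 20 * (k : ℝ) ^ 2 * (T.card * t) := by
      simp only [t]; field_simp
    rw [h]
    nlinarith [mul_le_mul_of_nonneg_left hTt (by positivity : 0 ≤ 20 * (k : ℝ) ^ 2)]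
  have hγk : γ * (320 * (k : ℝ) ^ 3) ≤ 1 := by
    have h := mul_le_mul_of_nonneg_right hγ' (by positivity : 0 ≤ 320 * (k : ℝ) ^ 3)
    refine h.trans_eq ?_
    field_simp
    norm_num
  have hTk : T.card * k ≤ n / 6 := by
    have h1 : T.card * k * (n - 1) ≤ n ^ 2 / 8 := by
      calc T.card * k * (n - 1) = k * (T.card * (n - 1)) := by ring
        _ ≤ k * (40 * (k : ℝ) ^ 2 * (γ * n ^ 2)) := by gcongr
        _ = γ * (320 * (k : ℝ) ^ 3) * (n ^ 2 / 8) := by ring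
        _ ≤ 1 * (n ^ 2 / 8) := by gcongr
        _ = n ^ 2 / 8 := one_mul _
    refine le_of_mul_le_mul_right (h1.trans ?_) hn1
    nlinarith
  let s : ℝ := 2 * t + 2 * β * (n - 1) + 1
  have hs0 : 0 ≤ s := by positivity
  have hsk : k * s * k ≤ n / 4 := by
    have hβk : β * (k : ℝ) ^ 2 ≤ 1 / 320 := by
      have h := mul_le_mul_of_nonneg_right hβ (by positivity : 0 ≤ (k : ℝ) ^ 2)
      refine h.trans_eq ?_
      field_simp
      norm_num
    have htk : t * (k : ℝ) ^ 2 = (n - 1) / 20 := by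
      simp only [t]; field_simp
    have hkk : 200 * (k : ℝ) ^ 2 ≤ n := by nlinarith [sq_nonneg (k : ℝ)]
    have h := mul_le_mul_of_nonneg_right hβk hn1.le
    calc k * s * k = 2 * (t * (k : ℝ) ^ 2) + 2 * (β * (k : ℝ) ^ 2 * (n - 1)) + (k : ℝ) ^ 2 := by
          simp only [s]; ring
      _ ≤ n / 4 := by rw [htk]; linarith
  have hsmall : ∀ u ∉ T, C u ≠ D u → ∀ m, m = C u ∨ m = D u →
      ((Finset.univ.filter fun v => D v = m).card : ℝ) ≤ s := by
    intro u hu hne m hm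
    have h1 := card_cluster_le_of_move L D u hne hm
    have h2 := hmove u
    have h3 : ∑ v, disagreeInd L D u v ≤ t := by simpa [T] using hu
    simp only [s]
    linarith
  have hlarge : ∀ i : Fin k,
      n / (2 * (k : ℝ)) ≤ ((Finset.univ.filter fun x => C x = i).card : ℝ) →
      s < ((Finset.univ.filter fun v => D v = i).card : ℝ) := by
    intro i hi
    by_contra! hle
    have hsub : (Finset.univ.filter fun x => C x = i) ⊆ T ∪ Finset.univ.filter fun v =>
        ((Finset.univ.filter fun w => D w = D v).card : ℝ) ≤ s := by
      intro v hv
      rw [Finset.mem_union]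
      refine or_iff_not_imp_left.mpr fun hvT => Finset.mem_filter.mpr ⟨Finset.mem_univ _, ?_⟩
      have hCv : C v = i := (Finset.mem_filter.mp hv).2
      by_cases hCD : C v = D v
      · rwa [← hCD, hCv]
      · exact hsmall v hvT hCD _ (Or.inr rfl)
    have hcard : ((Finset.univ.filter fun x => C x = i).card : ℝ) ≤ T.card + k * s := by
      refine le_trans ?_ (add_le_add_right (card_small_clusters_le D hs0) _)
      exact_mod_cast (Finset.card_le_card hsub).trans (Finset.card_union_le _ _)
    have h := hi.trans hcard
    rw [div_le_iff₀ (by positivity)] at h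
    linarith
  refine ⟨T.piecewise C D, fun i hi => ?_, ?_⟩
  · ext v
    simp only [Finset.mem_filter, Finset.mem_univ, true_and]
    by_cases hv : v ∈ T
    · simp [hv]
    · rw [Finset.piecewise_eq_of_notMem _ _ _ hv]
      by_cases hCD : C v = D v
      · rw [hCD]
      · have h := hsmall v hv hCD
        constructor
        · intro hD
          exact absurd (h i (Or.inr hD.symm)) (hlarge i hi).not_ge
        · intro hCi
          exact absurd (h i (Or.inl hCi.symm)) (hlarge i hi).not_ge
  · refine (disagreeCount_piecewise_le L C D T _ fun u _ => hmove u).trans ?_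
    rw [hγ]
    have hTn : (T.card : ℝ) ≤ 80 * (k : ℝ) ^ 2 * γ * (n - 1) := by
      refine le_of_mul_le_mul_right (hT.trans ?_) hn1
      have h : n ^ 2 ≤ 2 * (n - 1) ^ 2 := by nlinarith
      calc 40 * (k : ℝ) ^ 2 * (γ * n ^ 2)
          ≤ 40 * (k : ℝ) ^ 2 * (γ * (2 * (n - 1) ^ 2)) := by gcongr
        _ = 80 * (k : ℝ) ^ 2 * γ * (n - 1) * (n - 1) := by ring
    calc γ * n ^ 2 + T.card * (2 * β * (n - 1) + T.card)
        ≤ γ * n ^ 2 + T.card * (2 * β * (n - 1) + 80 * (k : ℝ) ^ 2 * γ * (n - 1)) := by gcongr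
      _ = γ * n ^ 2 + T.card * (n - 1) * (2 * β + 80 * (k : ℝ) ^ 2 * γ) := by ring
      _ ≤ γ * n ^ 2 + 40 * (k : ℝ) ^ 2 * (γ * n ^ 2) * (2 * β + 80 * (k : ℝ) ^ 2 * γ) := by
          gcongr
      _ = _ := by ring
end

section
/- Let G be a simple graph on a vertex set V of even size n ≥ 2. Form the sign-labeled complete graph G' on the vertex set V × {0,1,…,n}, where the edge between distinct vertices (u,a) and (v,b) is labeled + if u = v, or if a = 0, b = 0 and {u,v} is an edge of G; all other edges are labeled −. Then every 2-clustering of G' that minimizes the number of disagreements has both clusters of equal size n(n+1)/2, and for every v ∈ V the group {v} × {0,1,…,n} is entirely contained in one cluster. -/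
open Finset

/-- Labeling of the complete graph on V × Fin (n+1) from a simple graph G:
the edge between (u,a) and (v,b) is + iff u = v (same group), or
a = 0, b = 0 and {u,v} is an edge of G. -/
def biasLabel {V : Type*} [DecidableEq V] (G : SimpleGraph V) [DecidableRel G.Adj]
    (n : ℕ) : Sym2 (V × Fin (n + 1)) → Bool :=
  Sym2.lift
    ⟨fun p q => decide (p.1 = q.1 ∨ (p.2 = 0 ∧ q.2 = 0 ∧ G.Adj p.1 q.1)),
     fun p q => by
        apply decide_eq_decide.mpr
        constructor
        · rintro (h | ⟨h1, h2, h3⟩)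
          · exact Or.inl h.symm
          · exact Or.inr ⟨h2, h1, h3.symm⟩
        · rintro (h | ⟨h1, h2, h3⟩)
          · exact Or.inl h.symm
          · exact Or.inr ⟨h2, h1, h3.symm⟩⟩

/-- The spin of a point in a 2-clustering. -/
def clusterSign (i : Fin 2) : ℤ := if i = 0 then 1 else -1

/-- The Ising-type energy of a spin assignment `s` on `V × {0, …, n}`; up to an additive constant
it is four times the number of disagreements of the associated 2-clustering. -/
def biasEnergy {V : Type*} [Fintype V] (G : SimpleGraph V) [DecidableRel G.Adj] {n : ℕ}
    (s : V → Fin (n + 1) → ℤ) : ℤ :=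
  (∑ v, ∑ a, s v a) ^ 2 - 2 * ∑ v, (∑ a, s v a) ^ 2
    - 2 * ∑ u, ∑ v, (if G.Adj u v then 1 else 0) * (s u 0 * s v 0)

lemma two_mul_disagreeCount {V : Type*} [Fintype V] [DecidableEq V] {k : ℕ}
    (L : Sym2 V → Bool) (c : V → Fin k) :
    2 * disagreeCount L c =
      ∑ x, ∑ y, if x ≠ y ∧ sameBlock c s(x, y) ≠ L s(x, y) then 1 else 0 := by
  classical
  let H : SimpleGraph V := SimpleGraph.fromEdgeSet {e | sameBlock c e ≠ L e}
  have hcard : disagreeCount L c = H.edgeFinset.card := by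
    unfold disagreeCount edgeSet
    congr 1
    ext e
    simp [H, and_comm]
  have hdeg : 2 * H.edgeFinset.card = ∑ v, H.degree v := by
    convert H.sum_degrees_eq_twice_card_edges.symm
  rw [hcard, hdeg]
  refine Finset.sum_congr rfl fun x _ => ?_
  rw [← SimpleGraph.card_neighborFinset_eq_degree, SimpleGraph.neighborFinset_eq_filter,
    Finset.card_filter]
  refine Finset.sum_congr rfl fun y _ => ?_
  simp [H, and_comm]

lemma four_mul_disagreeCount_biasLabel {V : Type*} [Fintype V] [DecidableEq V]
    (G : SimpleGraph V) [DecidableRel G.Adj] {n : ℕ} (c : V × Fin (n + 1) → Fin 2) :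
    4 * (disagreeCount (biasLabel G n) c : ℤ) =
      (Fintype.card V * (n + 1)) ^ 2 + biasEnergy G fun v a => clusterSign (c (v, a)) := by
  set s : V → Fin (n + 1) → ℤ := fun v a => clusterSign (c (v, a)) with hs
  have hterm : ∀ x y : V × Fin (n + 1),
      2 * (if x ≠ y ∧ sameBlock c s(x, y) ≠ biasLabel G n s(x, y) then 1 else 0 : ℤ) =
        1 + s x.1 x.2 * s y.1 y.2 - 2 * (if x.1 = y.1 then s x.1 x.2 * s y.1 y.2 else 0)
          - 2 * (if x.2 = 0 then if y.2 = 0 then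
              (if G.Adj x.1 y.1 then 1 else 0) * (s x.1 x.2 * s y.1 y.2) else 0 else 0) := by
    rintro ⟨u, a⟩ ⟨v, b⟩
    have hadj : u = v → ¬ G.Adj u v := fun h => h ▸ G.loopless.irrefl _
    have hc : ∀ i : Fin 2, i = 0 ∨ i = 1 := by decide
    by_cases hxy : ((u, a) : V × Fin (n + 1)) = (v, b)
    · obtain ⟨rfl, rfl⟩ := Prod.mk.inj hxy
      rcases hc (c (u, a)) with h | h <;> simp [hs, clusterSign, h]
    · simp only [hs, clusterSign, sameBlock, biasLabel, Sym2.lift_mk]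
      rcases hc (c (u, a)) with h | h <;> rcases hc (c (v, b)) with h' | h' <;>
        by_cases huv : u = v <;> by_cases hG : G.Adj u v <;> by_cases ha : a = 0 <;>
        by_cases hb : b = 0 <;> simp_all
  have hD := congrArg (Nat.cast : ℕ → ℤ) (two_mul_disagreeCount (biasLabel G n) c)
  push_cast at hD
  have h4 : 4 * (disagreeCount (biasLabel G n) c : ℤ) =
      ∑ x : V × Fin (n + 1), ∑ y : V × Fin (n + 1),
      2 * (if x ≠ y ∧ sameBlock c s(x, y) ≠ biasLabel G n s(x, y) then 1 else 0 : ℤ) := by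
    simp only [← Finset.mul_sum]
    rw [← hD]; ring
  rw [h4]
  simp only [hterm, Finset.sum_sub_distrib, Finset.sum_add_distrib]
  have h1 : (∑ x : V × Fin (n + 1), ∑ y : V × Fin (n + 1), (1 : ℤ)) =
      (Fintype.card V * (n + 1)) ^ 2 := by
    simp; ring
  have h2 : (∑ x : V × Fin (n + 1), ∑ y : V × Fin (n + 1), s x.1 x.2 * s y.1 y.2) =
      (∑ v, ∑ a, s v a) ^ 2 := by
    rw [← Fintype.sum_prod_type' (f := s), sq, Finset.sum_mul_sum]
  have h3 : (∑ x : V × Fin (n + 1), ∑ y : V × Fin (n + 1),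
      if x.1 = y.1 then s x.1 x.2 * s y.1 y.2 else 0) = ∑ v, (∑ a, s v a) ^ 2 := by
    simp only [Fintype.sum_prod_type]
    refine Finset.sum_congr rfl fun u _ => ?_
    rw [sq, Finset.sum_mul_sum]
    refine Finset.sum_congr rfl fun a _ => ?_
    rw [Finset.sum_comm]
    simp
  have h5 : (∑ x : V × Fin (n + 1), ∑ y : V × Fin (n + 1), if x.2 = 0 then if y.2 = 0 then
      (if G.Adj x.1 y.1 then 1 else 0) * (s x.1 x.2 * s y.1 y.2) else 0 else 0) =
      ∑ u, ∑ v, (if G.Adj u v then 1 else 0) * (s u 0 * s v 0) := by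
    simp only [Fintype.sum_prod_type]
    refine Finset.sum_congr rfl fun u _ => ?_
    rw [Finset.sum_eq_single (0 : Fin (n + 1)) (fun a _ ha => by simp [ha]) (by simp)]
    refine Finset.sum_congr rfl fun v _ => ?_
    rw [Finset.sum_eq_single (0 : Fin (n + 1)) (fun a _ ha => by simp [ha]) (by simp)]
    simp
  rw [h1, h2]
  have hpull : ∀ f : V × Fin (n + 1) → V × Fin (n + 1) → ℤ,
      ∑ x, ∑ y, 2 * f x y = 2 * ∑ x, ∑ y, f x y := fun f => by simp only [Finset.mul_sum]
  rw [hpull, hpull, h3, h5]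
  unfold biasEnergy
  ring

lemma sum_sign_le_card_sub_two {ι : Type*} [Fintype ι] {f : ι → ℤ}
    (hf : ∀ i, f i = 1 ∨ f i = -1) {j : ι} (hj : f j = -1) :
    ∑ i, f i ≤ Fintype.card ι - 2 := by
  have h : 1 - f j ≤ ∑ i, (1 - f i) :=
    Finset.single_le_sum (f := fun i => 1 - f i)
      (fun i _ => by rcases hf i with h | h <;> simp [h]) (Finset.mem_univ j)
  rw [Finset.sum_sub_distrib, hj] at h
  simp at h
  linarith

lemma abs_sum_sign_le_card_sub_two {ι : Type*} [Fintype ι] {f : ι → ℤ}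
    (hf : ∀ i, f i = 1 ∨ f i = -1) {i j : ι} (hij : f i ≠ f j) :
    |∑ i, f i| ≤ Fintype.card ι - 2 := by
  have key : ∀ i j, f i = 1 → f j = -1 → |∑ i, f i| ≤ Fintype.card ι - 2 := by
    intro i j hi hj
    have h1 := sum_sign_le_card_sub_two hf hj
    have h2 := sum_sign_le_card_sub_two (f := fun i => - f i) (j := i)
      (fun i => by rcases hf i with h | h <;> simp [h]) (by simp [hi])
    rw [Finset.sum_neg_distrib] at h2
    exact abs_le.2 ⟨by linarith, h1⟩
  rcases hf i with hi | hi <;> rcases hf j with hj | hj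
  · exact absurd (hi.trans hj.symm) hij
  · exact key i j hi hj
  · exact key j i hj hi
  · exact absurd (hi.trans hj.symm) hij

/-- A sign vector of even length with nonnegative sum `2t` can be balanced by flipping `t` entries,
and this lowers the quadratic form of a graph by at most `4t(n-t)`. -/
lemma exists_balanced_sign {V : Type*} [Fintype V] (G : SimpleGraph V) [DecidableRel G.Adj]
    (heven : Even (Fintype.card V)) {σ : V → ℤ} (hσ : ∀ v, σ v = 1 ∨ σ v = -1)
    (h0 : 0 ≤ ∑ v, σ v) :
    ∃ (t : ℤ) (σ' : V → ℤ), 0 ≤ t ∧ ∑ v, σ v = 2 * t ∧ (∀ v, σ' v = 1 ∨ σ' v = -1) ∧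
      ∑ v, σ' v = 0 ∧
      (∑ u, ∑ v, (if G.Adj u v then 1 else 0) * (σ u * σ v)) -
        (∑ u, ∑ v, (if G.Adj u v then 1 else 0) * (σ' u * σ' v)) ≤
          4 * t * (Fintype.card V - t) := by
  classical
  obtain ⟨m, hm⟩ := heven
  set P : Finset V := Finset.univ.filter fun v => σ v = 1 with hP
  have hsum : ∑ v, σ v = 2 * (P.card : ℤ) - Fintype.card V := by
    have : ∀ v, σ v = 2 * (if σ v = 1 then 1 else 0) - 1 := fun v => by
      rcases hσ v with h | h <;> simp [h]
    rw [Finset.sum_congr rfl fun v _ => this v, Finset.sum_sub_distrib, ← Finset.mul_sum]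
    simp [hP]
  have hmP : m ≤ P.card := by
    rw [hsum, hm] at h0; push_cast at h0; omega
  obtain ⟨T, hTP, hT⟩ := Finset.exists_subset_card_eq (Nat.sub_le P.card m)
  have hTσ : ∀ v ∈ T, σ v = 1 := fun v hv => (Finset.mem_filter.1 (hTP hv)).2
  set τ : V → ℤ := fun v => if v ∈ T then 1 else 0 with hτ
  have hτsum : ∑ v, τ v = T.card := by simp [hτ]
  have h2t : ∑ v, σ v = 2 * (T.card : ℤ) := by
    rw [hsum, hm, hT, Nat.cast_sub hmP]; push_cast; ring
  refine ⟨T.card, fun v => σ v - 2 * τ v, by positivity, h2t, fun v => ?_, ?_, ?_⟩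
  · by_cases hv : v ∈ T
    · simp [hτ, hv, hTσ v hv]
    · simpa [hτ, hv] using hσ v
  · rw [Finset.sum_sub_distrib, ← Finset.mul_sum, hτsum, h2t, sub_self]
  · have hle : ∀ u v, (if G.Adj u v then 1 else 0) * (σ u * σ v) -
        (if G.Adj u v then 1 else 0) * ((σ u - 2 * τ u) * (σ v - 2 * τ v)) ≤
          2 * (τ u + τ v - 2 * (τ u * τ v)) := by
      intro u v
      by_cases hu : u ∈ T <;> by_cases hv : v ∈ T <;> split_ifs <;>
        rcases hσ u with h | h <;> rcases hσ v with h' | h' <;>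
        simp_all
    have hrhs : ∑ u, ∑ v, 2 * (τ u + τ v - 2 * (τ u * τ v)) =
        4 * (T.card : ℤ) * (Fintype.card V - T.card) := by
      simp only [← Finset.mul_sum, Finset.sum_sub_distrib, Finset.sum_add_distrib,
        ← Finset.sum_mul, hτsum]
      simp only [Finset.sum_const, Finset.card_univ, nsmul_eq_mul, ← Finset.mul_sum, hτsum]
      ring
    rw [← hrhs]
    simp only [← Finset.sum_sub_distrib]
    exact Finset.sum_le_sum fun u _ => Finset.sum_le_sum fun v _ => hle u v

lemma eq_zero_of_imbalance_bound {n t k S : ℤ} (hn : 2 ≤ n) (ht : 0 ≤ t) (hk : 0 ≤ k)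
    (hlow : 2 * t * (n + 1) - 2 * n * k ≤ S) (hbound : S ^ 2 + 8 * n * k ≤ 8 * t * (n - t)) :
    t = 0 ∧ k = 0 ∧ S = 0 := by
  have hkt : t ≤ k := by
    by_contra! hlt
    obtain ⟨j, rfl⟩ : ∃ j : ℤ, t = k + j := ⟨t - k, by ring⟩
    have hj1 : 1 ≤ j := by linarith
    have hjn : 2 ≤ j * n := by nlinarith
    have hSj : 2 * (j * n) ≤ S := by linarith
    have h1 : (2 * (j * n)) ^ 2 ≤ S ^ 2 := pow_le_pow_left₀ (by linarith) hSj 2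
    have h2 : 2 * (j * n) ≤ (j * n) * (j * n) := mul_le_mul_of_nonneg_right hjn (by linarith)
    have h3 : 0 < (k + j) * (k + j) := by positivity
    linarith
  have hnk : n * t ≤ n * k := mul_le_mul_of_nonneg_left hkt (by linarith)
  have ht2 : t * t ≤ 0 := by linarith [sq_nonneg S]
  have ht0 : t = 0 := mul_self_eq_zero.1 (le_antisymm ht2 (mul_self_nonneg t))
  subst ht0
  have hk0 : k = 0 := by nlinarith [sq_nonneg S]
  subst hk0
  have hS : S ^ 2 ≤ 0 := by linarith
  exact ⟨rfl, rfl, pow_eq_zero_iff two_ne_zero |>.1 (le_antisymm hS (sq_nonneg S))⟩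

/-- Spin assignments of minimal energy are balanced and constant on groups. -/
lemma balanced_of_biasEnergy_minimal {V : Type*} [Fintype V] (G : SimpleGraph V)
    [DecidableRel G.Adj] {n : ℕ} (hn : 2 ≤ n) (hcard : Fintype.card V = n) (heven : Even n)
    {s : V → Fin (n + 1) → ℤ} (hs : ∀ v a, s v a = 1 ∨ s v a = -1)
    (hmin : ∀ s' : V → Fin (n + 1) → ℤ, (∀ v a, s' v a = 1 ∨ s' v a = -1) →
      biasEnergy G s ≤ biasEnergy G s')
    (h0 : 0 ≤ ∑ v, s v 0) :
    ∑ v, ∑ a, s v a = 0 ∧ ∀ v a, s v a = s v 0 := by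
  classical
  obtain ⟨t, σ', ht, h2t, hσ', hσ'0, hA⟩ :=
    exists_balanced_sign G (hcard ▸ heven) (fun v => hs v 0) h0
  rw [hcard] at hA
  set K : Finset V := Finset.univ.filter fun v => ∃ a, s v a ≠ s v 0 with hK
  have hpure : ∀ v, v ∉ K → ∀ a, s v a = s v 0 := by
    intro v hv; simpa [hK] using hv
  have hpure_sum : ∀ v, v ∉ K → ∑ a, s v a = (n + 1) * s v 0 := by
    intro v hv
    rw [Finset.sum_congr rfl fun a _ => hpure v hv a]
    simp
  have hmixed : ∀ v, v ∈ K → |∑ a, s v a| ≤ n - 1 := by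
    intro v hv
    obtain ⟨a, ha⟩ := (Finset.mem_filter.1 hv).2
    have := abs_sum_sign_le_card_sub_two (hs v) ha
    simp at this
    linarith
  have hsq : ∀ v, (∑ a, s v a) ^ 2 ≤ (n + 1 : ℤ) ^ 2 - 4 * n * (if v ∈ K then 1 else 0) := by
    intro v
    by_cases hv : v ∈ K
    · have h := abs_le.1 (hmixed v hv)
      simp only [hv, if_true]
      nlinarith
    · rw [hpure_sum v hv, mul_pow, sq_eq_one_iff.2 (hs v 0)]
      simp [hv]
  have hlow : ∀ v, (n + 1 : ℤ) * s v 0 - 2 * n * (if v ∈ K then 1 else 0) ≤ ∑ a, s v a := by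
    intro v
    by_cases hv : v ∈ K
    · have h := abs_le.1 (hmixed v hv)
      simp only [hv, if_true]
      rcases hs v 0 with h' | h' <;> rw [h'] <;> linarith
    · simp [hpure_sum v hv, hv]
  have hKsum : ∑ v, (if v ∈ K then 1 else 0 : ℤ) = K.card := by simp
  have hsq_sum : ∑ v, (∑ a, s v a) ^ 2 ≤ n * (n + 1 : ℤ) ^ 2 - 4 * n * K.card := by
    refine (Finset.sum_le_sum fun v _ => hsq v).trans_eq ?_
    rw [Finset.sum_sub_distrib, ← Finset.mul_sum, hKsum]
    simp [hcard]
  have hlow_sum : 2 * t * (n + 1 : ℤ) - 2 * n * K.card ≤ ∑ v, ∑ a, s v a := by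
    refine le_trans (le_of_eq ?_) (Finset.sum_le_sum fun v _ => hlow v)
    rw [Finset.sum_sub_distrib, ← Finset.mul_sum, ← Finset.mul_sum, hKsum, h2t]
    ring
  have hE := hmin (fun v _ => σ' v) fun v _ => hσ' v
  have hE' : biasEnergy G (fun v (_ : Fin (n + 1)) => σ' v) = - 2 * (n * (n + 1 : ℤ) ^ 2)
      - 2 * ∑ u, ∑ v, (if G.Adj u v then 1 else 0) * (σ' u * σ' v) := by
    have hone : ∀ v, σ' v ^ 2 = 1 := fun v => by rcases hσ' v with h | h <;> simp [h]
    unfold biasEnergy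
    simp only [Finset.sum_const, Finset.card_univ, Fintype.card_fin, nsmul_eq_mul,
      ← Finset.mul_sum, hσ'0, mul_pow, hone, hcard]
    push_cast
    ring
  rw [hE'] at hE
  unfold biasEnergy at hE
  set S : ℤ := ∑ v, ∑ a, s v a with hS
  have hbound : S ^ 2 + 8 * n * K.card ≤ 8 * t * (n - t) := by linarith
  obtain ⟨-, hK0, hS0⟩ := eq_zero_of_imbalance_bound (by exact_mod_cast hn) ht
    (Int.natCast_nonneg K.card) hlow_sum hbound
  refine ⟨hS0, fun v => hpure v ?_⟩
  simp [Finset.card_eq_zero.1 (Int.natCast_eq_zero.1 hK0)]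

/-- for a simple graph G on an even number n ≥ 2 of vertices,
every 2-clustering of the derived labeled complete graph on V × {0,...,n}
minimizing disagreements has both clusters of size n(n+1)/2, and every group
{v} × {0,...,n} lies entirely in one cluster. -/
theorem stmt_10 {V : Type*} [Fintype V] [DecidableEq V]
    (G : SimpleGraph V) [DecidableRel G.Adj]
    (hn : 2 ≤ Fintype.card V) (heven : Even (Fintype.card V))
    (c : V × Fin (Fintype.card V + 1) → Fin 2)
    (hmin : ∀ c' : V × Fin (Fintype.card V + 1) → Fin 2,
      disagreeCount (biasLabel G (Fintype.card V)) c
        ≤ disagreeCount (biasLabel G (Fintype.card V)) c') :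
    (∀ i : Fin 2,
      (Finset.univ.filter fun x => c x = i).card
        = Fintype.card V * (Fintype.card V + 1) / 2)
    ∧ ∀ (v : V) (a b : Fin (Fintype.card V + 1)), c (v, a) = c (v, b) := by
  have hsgn : ∀ i, clusterSign i = 1 ∨ clusterSign i = -1 := by decide
  have hinj : Function.Injective clusterSign := by decide
  set s : V → Fin (Fintype.card V + 1) → ℤ := fun v a => clusterSign (c (v, a)) with hs
  have hs1 : ∀ v a, s v a = 1 ∨ s v a = -1 := fun v a => hsgn _
  have hE : ∀ s' : V → Fin (Fintype.card V + 1) → ℤ, (∀ v a, s' v a = 1 ∨ s' v a = -1) →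
      biasEnergy G s ≤ biasEnergy G s' := by
    intro s' hs'
    have h := hmin fun x => if s' x.1 x.2 = 1 then 0 else 1
    have h1 := four_mul_disagreeCount_biasLabel G c
    have h2 := four_mul_disagreeCount_biasLabel G
      (fun x : V × Fin (Fintype.card V + 1) => if s' x.1 x.2 = 1 then (0 : Fin 2) else 1)
    have h3 : (fun v a => clusterSign (if s' v a = 1 then (0 : Fin 2) else 1)) = s' := by
      funext v a
      rcases hs' v a with h | h <;> simp [h, clusterSign]
    simp only [h3] at h2
    zify at h
    linarith
  have hneg : biasEnergy G (fun v a => - s v a) = biasEnergy G s := by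
    simp [biasEnergy]
  have hmain : ∑ v, ∑ a, s v a = 0 ∧ ∀ v a, s v a = s v 0 := by
    rcases le_total 0 (∑ v, s v 0) with h0 | h0
    · exact balanced_of_biasEnergy_minimal G hn rfl heven hs1 hE h0
    · have := balanced_of_biasEnergy_minimal G hn rfl heven (s := fun v a => - s v a)
        (fun v a => by rcases hs1 v a with h | h <;> simp [h]) (by simpa only [hneg] using hE)
        (by simpa using h0)
      simpa using this
  obtain ⟨hsum, hconst⟩ := hmain
  refine ⟨?_, fun v a b => hinj ((hconst v a).trans (hconst v b).symm)⟩
  have htotal : (univ.filter fun x => c x = 0).card + (univ.filter fun x => c x = 1).card =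
      Fintype.card V * (Fintype.card V + 1) := by
    have h1 : (univ.filter fun x => c x = 1) = univ.filter fun x => ¬ c x = 0 := by
      ext x; simp; omega
    rw [h1, Finset.card_filter_add_card_filter_not]
    simp
  have hdiff : ((univ.filter fun x => c x = 0).card : ℤ) =
      (univ.filter fun x => c x = 1).card := by
    rw [← Fintype.sum_prod_type' (f := s)] at hsum
    have : ∀ x : V × Fin (Fintype.card V + 1), s x.1 x.2 =
        (if c x = 0 then 1 else 0) - (if c x = 1 then 1 else 0) := by
      intro x
      have hc : c x = 0 ∨ c x = 1 := by omega
      rcases hc with h | h <;> simp [hs, clusterSign, h]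
    simp only [this, Finset.sum_sub_distrib, Finset.sum_boole] at hsum
    simpa using sub_eq_zero.1 hsum
  rw [Fin.forall_fin_two]
  constructor <;> omega
end

section
/- Let L be a sign labeling of the complete graph on a finite vertex set V of size n ≥ 1, and let k ≥ 3. Form the sign-labeled complete graph on V' = V ⊔ ({1,…,k−2} × {1,…,n+1}), where edges within V keep their labels from L, every edge between two vertices (i,a) and (i,b) of the same group {i} × {1,…,n+1} is labeled +, and all remaining edges are labeled −. Then: (i) every k-clustering of V' minimizing the number of disagreements has, for each i ∈ {1,…,k−2}, the group {i} × {1,…,n+1} as exactly one of its clusters (in particular no vertex of V lies in a cluster containing group vertices); and (ii) the minimum number of disagreements over all k-clusterings of V' equals the minimum number of disagreements over all 2-clusterings of (V, L). -/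
open Finset

/-- The padded labeling on V ⊕ (Fin (k-2) × Fin (n+1)): edges within V keep their
labels from L, edges inside a group {i} × Fin (n+1) are +, all other edges are -. -/
def padLabel {V : Type*} (L : Sym2 V → Bool) (k n : ℕ) :
    Sym2 (V ⊕ (Fin (k - 2) × Fin (n + 1))) → Bool :=
  Sym2.lift
    ⟨fun x y =>
      match x, y with
      | Sum.inl u, Sum.inl v => L s(u, v)
      | Sum.inr p, Sum.inr q => decide (p.1 = q.1)
      | _, _ => false,
     fun x y => by
      rcases x with u | p <;> rcases y with v | q <;>
        simp [Sym2.eq_swap, eq_comm]⟩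

/-- The number of disagreeing edges at `v` after `v` is moved to cluster `j`. -/
def vertexCost {V : Type*} [Fintype V] [DecidableEq V] {k : ℕ}
    (L : Sym2 V → Bool) (c : V → Fin k) (v : V) (j : Fin k) : ℕ :=
  (univ.filter fun y => y ≠ v ∧ decide (j = c y) ≠ L s(v, y)).card

section Clustering

variable {V : Type*} [Fintype V] [DecidableEq V] {k : ℕ} (L : Sym2 V → Bool)

theorem disagreeCount_eq_of_ker_eq {l : ℕ} (c : V → Fin k) (c' : V → Fin l)
    (h : ∀ x y, c x = c y ↔ c' x = c' y) : disagreeCount L c = disagreeCount L c' := by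
  unfold disagreeCount
  congr 1
  refine filter_congr fun e _ => ?_
  induction e with
  | _ x y => simp [sameBlock, h]

/-- The disagreeing edges split into those avoiding `v` and those at `v`. -/
theorem disagreeCount_eq_add_vertexCost (c : V → Fin k) (v : V) :
    disagreeCount L c =
      ((edgeSet V).filter fun e => sameBlock c e ≠ L e ∧ v ∉ e).card
        + vertexCost L c v (c v) := by
  unfold disagreeCount vertexCost
  rw [← card_filter_add_card_filter_not (s := (edgeSet V).filter fun e => sameBlock c e ≠ L e)
    (fun e => v ∉ e), filter_filter, filter_filter]
  congr 1
  rw [← card_image_of_injective (f := fun y => s(v, y)) _ (fun a b h => Sym2.congr_right.1 h)]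
  congr 1
  ext e
  simp only [mem_filter, mem_image, mem_univ, true_and, not_not, edgeSet]
  constructor
  · rintro ⟨hd, hs, y, rfl⟩
    exact ⟨y, ⟨fun h => hd (by simp [h]), by simpa [sameBlock] using hs⟩, rfl⟩
  · rintro ⟨y, ⟨hy, hs⟩, rfl⟩
    exact ⟨by simpa using hy.symm, by simpa [sameBlock] using hs, by simp⟩

theorem vertexCost_update (c : V → Fin k) (v : V) (i j : Fin k) :
    vertexCost L (Function.update c v i) v j = vertexCost L c v j := by
  unfold vertexCost
  congr 1
  refine filter_congr fun y _ => and_congr_right fun hy => ?_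
  rw [Function.update_of_ne hy]

variable {L}

theorem vertexCost_le_of_minimal {c : V → Fin k}
    (hc : ∀ c' : V → Fin k, disagreeCount L c ≤ disagreeCount L c') (v : V) (j : Fin k) :
    vertexCost L c v (c v) ≤ vertexCost L c v j := by
  have h := hc (Function.update c v j)
  rw [disagreeCount_eq_add_vertexCost L c v,
    disagreeCount_eq_add_vertexCost L (Function.update c v j) v, vertexCost_update,
    Function.update_self] at h
  have h_avoid : ((edgeSet V).filter fun e => sameBlock c e ≠ L e ∧ v ∉ e) =
      (edgeSet V).filter fun e => sameBlock (Function.update c v j) e ≠ L e ∧ v ∉ e := by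
    refine filter_congr fun e _ => and_congr_left fun he => ?_
    induction e with
    | _ x y =>
      simp only [Sym2.mem_iff, not_or] at he
      simp [sameBlock, Function.update_of_ne (Ne.symm he.1), Function.update_of_ne (Ne.symm he.2)]
  rw [h_avoid] at h
  omega

/-- A minimizer never separates two vertices joined by a `+` edge whose remaining edges carry
the same labels. -/
theorem eq_of_minimal_of_twins {c : V → Fin k}
    (hc : ∀ c' : V → Fin k, disagreeCount L c ≤ disagreeCount L c') {v w : V}
    (hL : L s(v, w) = true) (htwin : ∀ y, y ≠ v → y ≠ w → L s(v, y) = L s(w, y)) :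
    c v = c w := by
  by_contra hne
  have key : ∀ v w : V, c v ≠ c w → L s(v, w) = true →
      (∀ y, y ≠ v → y ≠ w → L s(v, y) = L s(w, y)) →
      vertexCost L c v (c w) < vertexCost L c w (c w) := by
    intro v w hne hL htwin
    refine card_lt_card (ssubset_iff_of_subset ?_ |>.2 ⟨v, ?_, by simp⟩)
    · intro y hy
      simp only [mem_filter, mem_univ, true_and] at hy ⊢
      have hyw : y ≠ w := by
        rintro rfl
        exact hy.2 (by simp [hL])
      exact ⟨hyw, htwin y hy.1 hyw ▸ hy.2⟩
    · have hvw : v ≠ w := fun h => hne (congrArg c h)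
      simp [hvw, Sym2.eq_swap (a := w), hL, Ne.symm hne]
  have h₁ := key v w hne hL htwin
  have h₂ := key w v (Ne.symm hne) (by rwa [Sym2.eq_swap])
    (fun y hw hv => (htwin y hv hw).symm)
  have h₃ := vertexCost_le_of_minimal hc v (c w)
  have h₄ := vertexCost_le_of_minimal hc w (c v)
  omega

theorem disagreeCount_le_card_sq (c : V → Fin k) :
    disagreeCount L c ≤ Fintype.card V * Fintype.card V := by
  rw [← Fintype.card_prod]
  exact (card_le_univ _).trans
    (Fintype.card_le_of_surjective (fun p : V × V => s(p.1, p.2)) fun e => by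
      induction e with
      | _ x y => exact ⟨(x, y), rfl⟩)

end Clustering

section Padding

variable {V : Type*} [Fintype V] [DecidableEq V] {k n : ℕ} {L : Sym2 V → Bool}

/-- A clustering having every group as one of its clusters only disagrees inside `V`. -/
theorem disagreeCount_padLabel {l : ℕ} {c : V ⊕ (Fin (k - 2) × Fin (n + 1)) → Fin l}
    (hgroup : ∀ p q, c (Sum.inr p) = c (Sum.inr q) ↔ p.1 = q.1)
    (hsep : ∀ v p, c (Sum.inl v) ≠ c (Sum.inr p)) :
    disagreeCount (padLabel L k n) c = disagreeCount L (c ∘ Sum.inl) := by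
  unfold disagreeCount
  rw [← card_image_of_injective (s := (edgeSet V).filter _)
    (Sym2.map.injective (Sum.inl_injective (β := Fin (k - 2) × Fin (n + 1))))]
  congr 1
  ext e
  simp only [mem_filter, mem_image, edgeSet, mem_univ, true_and]
  constructor
  · induction e with
    | _ x y =>
      rcases x with u | p <;> rcases y with v | q <;> rintro ⟨hd, hs⟩
      · exact ⟨s(u, v), ⟨by simpa using hd, by simpa [sameBlock, padLabel] using hs⟩, by simp⟩
      · simp [sameBlock, padLabel, hsep] at hs
      · simp [sameBlock, padLabel, (hsep _ _).symm] at hs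
      · simp [sameBlock, padLabel, hgroup] at hs
  · rintro ⟨e, ⟨hd, hs⟩, rfl⟩
    induction e with
    | _ x y => exact ⟨by simpa using hd, by simpa [sameBlock, padLabel] using hs⟩

/-- Every 2-clustering of `V` extends to a `k`-clustering of the padded instance with the same
number of disagreements. -/
theorem exists_disagreeCount_padLabel_eq (hk : 2 ≤ k) (c : V → Fin 2) :
    ∃ c' : V ⊕ (Fin (k - 2) × Fin (n + 1)) → Fin k,
      disagreeCount (padLabel L k n) c' = disagreeCount L c := by
  let f : Fin 2 ⊕ Fin (k - 2) ≃ Fin k := finSumFinEquiv.trans (finCongr (by omega))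
  refine ⟨Sum.elim (fun v => f (Sum.inl (c v))) (fun p => f (Sum.inr p.1)), ?_⟩
  rw [disagreeCount_padLabel (by simp) (by simp)]
  exact disagreeCount_eq_of_ker_eq L _ _ (by simp)

/-- Merging two groups creates at least `(n + 1)²` disagreements. -/
theorem card_sq_le_disagreeCount_padLabel {l : ℕ}
    {c : V ⊕ (Fin (k - 2) × Fin (n + 1)) → Fin l} {i i' : Fin (k - 2)} (hi : i ≠ i')
    (hc : ∀ a b, c (Sum.inr (i, a)) = c (Sum.inr (i', b))) :
    (n + 1) * (n + 1) ≤ disagreeCount (padLabel L k n) c := by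
  let f : Fin (n + 1) × Fin (n + 1) → Sym2 (V ⊕ (Fin (k - 2) × Fin (n + 1))) :=
    fun p => s(Sum.inr (i, p.1), Sum.inr (i', p.2))
  have hf : Function.Injective f := by
    rintro ⟨a, b⟩ ⟨a', b'⟩ h
    simpa [f, hi, hi.symm] using h
  calc (n + 1) * (n + 1) = ((univ : Finset (Fin (n + 1) × Fin (n + 1))).image f).card := by
        rw [card_image_of_injective _ hf]; simp
    _ ≤ _ := by
        refine card_le_card fun e he => ?_
        obtain ⟨p, -, rfl⟩ := mem_image.1 he
        rw [mem_filter]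
        simp [f, edgeSet, sameBlock, padLabel, hi, hc p.1 p.2]

/-- In a minimizer for the padded instance, two group vertices share a cluster exactly when they
belong to the same group. -/
theorem group_eq_iff_of_minimal (hk : 2 ≤ k) (hn : Fintype.card V = n)
    {c : V ⊕ (Fin (k - 2) × Fin (n + 1)) → Fin k}
    (hc : ∀ c' : V ⊕ (Fin (k - 2) × Fin (n + 1)) → Fin k,
      disagreeCount (padLabel L k n) c ≤ disagreeCount (padLabel L k n) c')
    (p q : Fin (k - 2) × Fin (n + 1)) :
    c (Sum.inr p) = c (Sum.inr q) ↔ p.1 = q.1 := by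
  have hsame : ∀ p q : Fin (k - 2) × Fin (n + 1), p.1 = q.1 →
      c (Sum.inr p) = c (Sum.inr q) := by
    intro p q hpq
    refine eq_of_minimal_of_twins hc (by simp [padLabel, hpq]) fun y _ _ => ?_
    rcases y with v | r <;> simp [padLabel, hpq]
  refine ⟨fun h => ?_, hsame p q⟩
  by_contra hne
  have hlower := card_sq_le_disagreeCount_padLabel (L := L) (c := c) hne fun a b =>
    (hsame (p.1, a) p rfl).trans (h.trans (hsame q (q.1, b) rfl))
  obtain ⟨c', hc'⟩ := exists_disagreeCount_padLabel_eq (L := L) (n := n) hk (fun _ => 0)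
  have hupper := disagreeCount_le_card_sq (L := L) (fun _ => (0 : Fin 2))
  have := hc c'
  rw [hn] at hupper
  nlinarith

/-- In a minimizer for the padded instance, no vertex of `V` shares a cluster with a group
vertex. -/
theorem inl_ne_inr_of_minimal (hk : 2 ≤ k) (hn : Fintype.card V = n)
    {c : V ⊕ (Fin (k - 2) × Fin (n + 1)) → Fin k}
    (hc : ∀ c' : V ⊕ (Fin (k - 2) × Fin (n + 1)) → Fin k,
      disagreeCount (padLabel L k n) c ≤ disagreeCount (padLabel L k n) c')
    (v : V) (p : Fin (k - 2) × Fin (n + 1)) :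
    c (Sum.inl v) ≠ c (Sum.inr p) := by
  intro h
  have hgroup := group_eq_iff_of_minimal hk hn hc
  obtain ⟨j, hj⟩ : ∃ j : Fin k, ∀ q, c (Sum.inr q) ≠ j := by
    by_contra! hsurj
    have hcard := Fintype.card_le_of_surjective
      (fun i : Fin (k - 2) => c (Sum.inr (i, 0))) fun j => by
        obtain ⟨q, hq⟩ := hsurj j
        exact ⟨q.1, ((hgroup (q.1, 0) q).2 rfl).trans hq⟩
    simp only [Fintype.card_fin] at hcard
    omega
  have hlower : n + 1 ≤ vertexCost (padLabel L k n) c (Sum.inl v) (c (Sum.inl v)) := by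
    calc n + 1 = ((univ : Finset (Fin (n + 1))).image fun a =>
          (Sum.inr (p.1, a) : V ⊕ (Fin (k - 2) × Fin (n + 1)))).card := by
          rw [card_image_of_injective _ fun a b hab => by simpa using hab]; simp
      _ ≤ _ := by
          refine card_le_card fun y hy => ?_
          obtain ⟨a, -, rfl⟩ := mem_image.1 hy
          simp [padLabel, h, hgroup]
  have hupper : vertexCost (padLabel L k n) c (Sum.inl v) j ≤ n := by
    calc _ ≤ ((univ : Finset V).image
          (Sum.inl : V → V ⊕ (Fin (k - 2) × Fin (n + 1)))).card := by
          refine card_le_card fun y hy => ?_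
          rcases y with u | q
          · simp
          · have hq := (mem_filter.1 hy).2.2
            simp [padLabel, (hj q).symm] at hq
      _ ≤ n := hn ▸ card_image_le
  have := vertexCost_le_of_minimal hc (Sum.inl v) j
  omega

/-- A map to `Fin k` avoiding the range of an injection from `Fin (k - 2)` has the same kernel
as a map to `Fin 2`. -/
theorem exists_fin_two_ker_eq {W : Type*} (hk : 2 ≤ k) {g : Fin (k - 2) → Fin k}
    (hg : Function.Injective g) {c : W → Fin k} (hc : ∀ w i, c w ≠ g i) :
    ∃ c' : W → Fin 2, ∀ x y, c x = c y ↔ c' x = c' y := by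
  have hcard : Fintype.card {j // j ∉ Set.range g} = 2 := by
    have hrange : Fintype.card {j // j ∈ Set.range g} = k - 2 :=
      (Set.card_range_of_injective hg).trans (Fintype.card_fin _)
    rw [Fintype.card_subtype_compl, Fintype.card_fin, hrange]
    omega
  let e := Fintype.equivFinOfCardEq hcard
  refine ⟨fun w => e ⟨c w, fun ⟨i, hi⟩ => hc w i hi.symm⟩, fun x y => ?_⟩
  simp

end Padding

/-- for n ≥ 1 and k ≥ 3: (i) every k-clustering of the padded instance
minimizing disagreements has each group as exactly one of its clusters (in particular
no vertex of V shares a cluster with a group vertex); (ii) the minimum number of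
disagreements over k-clusterings of the padded instance equals the minimum number of
disagreements over 2-clusterings of (V, L). -/
theorem stmt_12 {V : Type*} [Fintype V] [DecidableEq V]
    (L : Sym2 V → Bool) (hn : 1 ≤ Fintype.card V) (k : ℕ) (hk : 3 ≤ k) :
    (∀ c : V ⊕ (Fin (k - 2) × Fin (Fintype.card V + 1)) → Fin k,
      (∀ c' : V ⊕ (Fin (k - 2) × Fin (Fintype.card V + 1)) → Fin k,
        disagreeCount (padLabel L k (Fintype.card V)) c
          ≤ disagreeCount (padLabel L k (Fintype.card V)) c') →
      ∀ i : Fin (k - 2), ∃ j : Fin k,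
        (Finset.univ.filter fun x => c x = j)
          = (Finset.univ : Finset (Fin (Fintype.card V + 1))).image
              (fun a => (Sum.inr (i, a) : V ⊕ (Fin (k - 2) × Fin (Fintype.card V + 1))))
        ∧ ∀ (v : V) (a : Fin (Fintype.card V + 1)),
            c (Sum.inl v) ≠ c (Sum.inr (i, a)))
    ∧ sInf {d : ℕ | ∃ c : V ⊕ (Fin (k - 2) × Fin (Fintype.card V + 1)) → Fin k,
          disagreeCount (padLabel L k (Fintype.card V)) c = d}
        = sInf {d : ℕ | ∃ c : V → Fin 2, disagreeCount L c = d} := by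
  have hk2 : 2 ≤ k := by omega
  refine ⟨fun c hc i => ⟨c (Sum.inr (i, 0)), ?_, fun v a => inl_ne_inr_of_minimal hk2 rfl hc v _⟩,
    ?_⟩
  · ext x
    rcases x with v | ⟨i', a⟩
    · simp [inl_ne_inr_of_minimal hk2 rfl hc]
    · simp [group_eq_iff_of_minimal hk2 rfl hc, eq_comm]
  · apply le_antisymm
    · obtain ⟨c, hc⟩ := Nat.sInf_mem (s := {d : ℕ | ∃ c : V → Fin 2, disagreeCount L c = d})
        ⟨_, fun _ => 0, rfl⟩
      obtain ⟨c', hc'⟩ := exists_disagreeCount_padLabel_eq (L := L) (n := Fintype.card V) hk2 c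
      exact Nat.sInf_le ⟨c', hc'.trans hc⟩
    · obtain ⟨c, hc⟩ := Nat.sInf_mem
        (s := {d : ℕ | ∃ c : V ⊕ (Fin (k - 2) × Fin (Fintype.card V + 1)) → Fin k,
          disagreeCount (padLabel L k (Fintype.card V)) c = d})
        ⟨_, fun _ => ⟨0, by omega⟩, rfl⟩
      have hmin : ∀ c' : V ⊕ (Fin (k - 2) × Fin (Fintype.card V + 1)) → Fin k,
          disagreeCount (padLabel L k (Fintype.card V)) c
            ≤ disagreeCount (padLabel L k (Fintype.card V)) c' :=
        fun c' => hc ▸ Nat.sInf_le ⟨c', rfl⟩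
      have hgroup := group_eq_iff_of_minimal hk2 rfl hmin
      have hsep := inl_ne_inr_of_minimal hk2 rfl hmin
      obtain ⟨c', hc'⟩ := exists_fin_two_ker_eq hk2 (g := fun i => c (Sum.inr (i, 0)))
        (fun i i' h => (hgroup _ _).1 h) (c := c ∘ Sum.inl) fun v i => hsep v _
      refine Nat.sInf_le ⟨c', ?_⟩
      rw [← hc, disagreeCount_padLabel hgroup hsep]
      exact (disagreeCount_eq_of_ker_eq L _ _ hc').symm
end

section
/- Let U and W be nonempty finite sets, let k, r, m be positive integers, let ε, δ ∈ (0,1), and for each v ∈ W and each j ∈ {1,…,k} let T_{v,j} ⊆ U be a subset. Draw u₁,…,u_r independently and uniformly at random from U. If 2·exp(−2·(ε/32)²·r) ≤ εδ/(32mk), then with probability at least 1 − δ/(4m) the following holds: for every j ∈ {1,…,k}, the number of v ∈ W with |(1/r)·#{l : u_l ∈ T_{v,j}} − |T_{v,j}|/|U|| > ε/32 is at most (ε/8)·|W|. -/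
/-- **Hoeffding's lemma** for the uniform distribution on a finite type. -/
theorem sum_exp_mul_le_of_sum_eq_zero {U : Type*} [Fintype U] [Nonempty U] (g : U → ℝ) (a b : ℝ)
    (hg : ∀ u, g u ∈ Set.Icc a b) (hsum : ∑ u, g u = 0) (t : ℝ) :
    ∑ u, Real.exp (t * g u) ≤ Fintype.card U * Real.exp (t ^ 2 * (b - a) ^ 2 / 8) := by
  let _ : MeasurableSpace U := ⊤
  have hint (f : U → ℝ) : ∫ u, f u ∂(PMF.uniformOfFintype U).toMeasure
      = (Fintype.card U : ℝ)⁻¹ * ∑ u, f u := by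
    rw [PMF.integral_eq_sum, Finset.mul_sum]
    simp
  have h := (ProbabilityTheory.hasSubgaussianMGF_of_mem_Icc_of_integral_eq_zero
    (μ := (PMF.uniformOfFintype U).toMeasure) (X := g) (a := a) (b := b)
    (measurable_from_top.aemeasurable) (Filter.Eventually.of_forall hg)
    (by rw [hint, hsum, mul_zero])).mgf_le t
  rw [ProbabilityTheory.mgf, hint, inv_mul_le_iff₀ (by positivity)] at h
  refine h.trans_eq ?_
  congr 2
  push_cast
  rw [Real.norm_eq_abs, div_pow, sq_abs]
  ring

/-- **Hoeffding's inequality**, one-sided, as a count of the samples in `U ^ r`. -/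
theorem card_le_sum_le_exp {U : Type*} [Fintype U] [Nonempty U] (g : U → ℝ) (a : ℝ)
    (hg : ∀ u, g u ∈ Set.Icc a (a + 1)) (hsum : ∑ u, g u = 0) (r : ℕ) {c : ℝ} (hc : 0 ≤ c) :
    ((Finset.univ.filter fun s : Fin r → U => c * r ≤ ∑ l, g (s l)).card : ℝ)
      ≤ (Fintype.card U : ℝ) ^ r * Real.exp (-2 * c ^ 2 * r) := by
  classical
  calc ((Finset.univ.filter fun s : Fin r → U => c * r ≤ ∑ l, g (s l)).card : ℝ)
      = ∑ s : Fin r → U, if c * r ≤ ∑ l, g (s l) then (1 : ℝ) else 0 := by simp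
    _ ≤ ∑ s : Fin r → U, Real.exp (-(4 * c ^ 2 * r)) * ∏ l, Real.exp (4 * c * g (s l)) := by
      refine Finset.sum_le_sum fun s _ => ?_
      split_ifs with h
      · rw [← Real.exp_sum, ← Real.exp_add, ← Finset.mul_sum, Real.one_le_exp_iff]
        nlinarith
      · positivity
    _ = Real.exp (-(4 * c ^ 2 * r)) * (∑ u, Real.exp (4 * c * g u)) ^ r := by
      rw [← Finset.mul_sum, ← Fintype.piFinset_univ,
        ← Finset.prod_univ_sum (fun _ : Fin r => Finset.univ) fun _ u => Real.exp (4 * c * g u)]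
      simp
    _ ≤ Real.exp (-(4 * c ^ 2 * r)) *
        (Fintype.card U * Real.exp ((4 * c) ^ 2 * (a + 1 - a) ^ 2 / 8)) ^ r := by
      gcongr
      exact sum_exp_mul_le_of_sum_eq_zero g a (a + 1) hg hsum (4 * c)
    _ = (Fintype.card U : ℝ) ^ r * Real.exp (-2 * c ^ 2 * r) := by
      rw [mul_pow, ← Real.exp_nat_mul, mul_left_comm, ← Real.exp_add]
      ring_nf

open Classical in
/-- **Hoeffding's inequality**, two-sided, for the sampled frequency of a subset. -/
theorem card_lt_abs_frequency_sub_le {U : Type*} [Fintype U] [Nonempty U] (T : Finset U)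
    {r : ℕ} (hr : 0 < r) {c : ℝ} (hc : 0 ≤ c) :
    ((Finset.univ.filter fun s : Fin r → U =>
        c < |((Finset.univ.filter fun l : Fin r => s l ∈ T).card : ℝ) / r
          - (T.card : ℝ) / (Fintype.card U : ℝ)|).card : ℝ)
      ≤ (Fintype.card U : ℝ) ^ r * (2 * Real.exp (-2 * c ^ 2 * r)) := by
  set p : ℝ := (T.card : ℝ) / (Fintype.card U : ℝ) with hp
  set g : U → ℝ := fun u => (if u ∈ T then 1 else 0) - p with hg
  have hU : (0 : ℝ) < Fintype.card U := by positivity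
  have hr' : (0 : ℝ) < r := by positivity
  have hsum : ∑ u, g u = 0 := by
    simp only [hg, Finset.sum_sub_distrib, Finset.sum_const, nsmul_eq_mul, Finset.card_univ, hp]
    rw [mul_div_cancel₀ _ hU.ne']
    simp
  have hfreq (s : Fin r → U) : ∑ l, g (s l) =
      (((Finset.univ.filter fun l : Fin r => s l ∈ T).card : ℝ) / r - p) * r := by
    rw [sub_mul, div_mul_cancel₀ _ hr'.ne']
    simp [hg, mul_comm]
  have hup := card_le_sum_le_exp g (-p)
    (fun u => by simp only [hg]; split_ifs <;> constructor <;> linarith) hsum r hc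
  have hlow := card_le_sum_le_exp (fun u => -g u) (p - 1)
    (fun u => by simp only [hg]; split_ifs <;> constructor <;> linarith)
    (by rw [Finset.sum_neg_distrib, hsum, neg_zero]) r hc
  have hsub : (Finset.univ.filter fun s : Fin r → U =>
        c < |((Finset.univ.filter fun l : Fin r => s l ∈ T).card : ℝ) / r - p|) ⊆
      (Finset.univ.filter fun s : Fin r → U => c * r ≤ ∑ l, g (s l)) ∪
        (Finset.univ.filter fun s : Fin r → U => c * r ≤ ∑ l, -g (s l)) := by
    intro s hs
    simp only [Finset.mem_union, Finset.mem_filter, Finset.mem_univ, true_and,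
      Finset.sum_neg_distrib, hfreq, ← neg_mul] at hs ⊢
    rcases lt_abs.1 hs with h | h
    · exact Or.inl (by gcongr)
    · exact Or.inr (by gcongr)
  have hcard := (Finset.card_le_card hsub).trans (Finset.card_union_le _ _)
  have hcard' : ((Finset.univ.filter fun s : Fin r → U =>
        c < |((Finset.univ.filter fun l : Fin r => s l ∈ T).card : ℝ) / r - p|).card : ℝ) ≤
      (Finset.univ.filter fun s : Fin r → U => c * r ≤ ∑ l, g (s l)).card +
        (Finset.univ.filter fun s : Fin r → U => c * r ≤ ∑ l, -g (s l)).card := by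
    exact_mod_cast hcard
  linarith

open Classical in
/-- **Markov's inequality** for the number of `v` related to a uniformly random `s`. -/
theorem mul_card_lt_card_filter_le {S W : Type*} [Fintype S] [Fintype W] (B : S → W → Prop)
    (x y : ℝ)
    (hB : ∀ v, ((Finset.univ.filter fun s => B s v).card : ℝ) ≤ y) :
    x * (Finset.univ.filter fun s =>
        x < ((Finset.univ.filter fun v => B s v).card : ℝ)).card ≤ Fintype.card W * y := by
  calc x * (Finset.univ.filter fun s =>
        x < ((Finset.univ.filter fun v => B s v).card : ℝ)).card
      = ∑ s, if x < ((Finset.univ.filter fun v => B s v).card : ℝ) then x else 0 := by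
        simp [← Finset.sum_filter, mul_comm]
    _ ≤ ∑ s, ((Finset.univ.filter fun v => B s v).card : ℝ) := by
      refine Finset.sum_le_sum fun s _ => ?_
      split_ifs with h
      · exact h.le
      · positivity
    _ = ∑ v, ((Finset.univ.filter fun s => B s v).card : ℝ) := by
      exact_mod_cast Finset.sum_card_bipartiteAbove_eq_sum_card_bipartiteBelow B
    _ ≤ ∑ _v : W, y := Finset.sum_le_sum fun v _ => hB v
    _ = Fintype.card W * y := by simp


/- STATEMENT 13: for finite nonempty U, W, subsets T v j ⊆ U, and r independent
uniform draws u₁,...,u_r from U: if 2·exp(-2(ε/32)²r) ≤ εδ/(32mk), then with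
probability at least 1 - δ/(4m) (over the uniform distribution on U^r), for every
j the number of v ∈ W whose sampled frequency for T v j deviates from |T v j|/|U|
by more than ε/32 is at most (ε/8)|W|. -/
open Classical in
theorem stmt_13 {U W : Type*} [Fintype U] [Fintype W] [Nonempty U] [Nonempty W]
    (k r m : ℕ) (hk : 0 < k) (hr : 0 < r) (hm : 0 < m)
    (ε δ : ℝ) (hε : ε ∈ Set.Ioo (0 : ℝ) 1) (hδ : δ ∈ Set.Ioo (0 : ℝ) 1)
    (T : W → Fin k → Finset U)
    (hcond : 2 * Real.exp (-2 * (ε / 32) ^ 2 * (r : ℝ)) ≤ ε * δ / (32 * m * k)) :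
    1 - δ / (4 * m) ≤
      ((Finset.univ.filter fun s : Fin r → U =>
          ∀ j : Fin k,
            ((Finset.univ.filter fun v : W =>
                ε / 32 <
                  |((Finset.univ.filter fun l : Fin r => s l ∈ T v j).card : ℝ) / r
                    - ((T v j).card : ℝ) / (Fintype.card U : ℝ)|).card : ℝ)
              ≤ ε / 8 * (Fintype.card W : ℝ)).card : ℝ)
        / (Fintype.card (Fin r → U) : ℝ) := by
  obtain ⟨hε0, -⟩ := hε
  set bad : Fin k → (Fin r → U) → W → Prop := fun j s v => ε / 32 <
    |((Finset.univ.filter fun l : Fin r => s l ∈ T v j).card : ℝ) / r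
      - ((T v j).card : ℝ) / (Fintype.card U : ℝ)|
  have hk' : (0 : ℝ) < k := by positivity
  have hm' : (0 : ℝ) < m := by positivity
  have hW : (0 : ℝ) < Fintype.card W := by positivity
  set N : ℝ := (Fintype.card U : ℝ) ^ r with hN
  have hN0 : 0 < N := by positivity
  have hbad (j : Fin k) (v : W) :
      ((Finset.univ.filter fun s => bad j s v).card : ℝ) ≤ N * (ε * δ / (32 * m * k)) :=
    (card_lt_abs_frequency_sub_le (T v j) hr (by positivity)).trans (by gcongr)
  set many : Fin k → Finset (Fin r → U) := fun j => Finset.univ.filter fun s =>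
    ε / 8 * (Fintype.card W : ℝ) < ((Finset.univ.filter fun v => bad j s v).card : ℝ) with hmany
  have hmarkov (j : Fin k) : ((many j).card : ℝ) ≤ N * (δ / (4 * m * k)) := by
    have h := mul_card_lt_card_filter_le (bad j) (ε / 8 * (Fintype.card W : ℝ)) _
      (hbad j)
    refine le_of_mul_le_mul_left (h.trans_eq ?_)
      (show 0 < ε / 8 * (Fintype.card W : ℝ) by positivity)
    field_simp
    ring
  have hunion : ((Finset.univ.biUnion many).card : ℝ) ≤ N * (δ / (4 * m)) :=
    calc ((Finset.univ.biUnion many).card : ℝ) ≤ ∑ j, ((many j).card : ℝ) := by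
          exact_mod_cast Finset.card_biUnion_le
      _ ≤ ∑ _j : Fin k, N * (δ / (4 * m * k)) := Finset.sum_le_sum fun j _ => hmarkov j
      _ = N * (δ / (4 * m)) := by
        rw [Finset.sum_const, Finset.card_univ, Fintype.card_fin, nsmul_eq_mul]
        field_simp
  have hcompl : (Finset.univ.filter fun s : Fin r → U => ∀ j : Fin k,
      ((Finset.univ.filter fun v => bad j s v).card : ℝ) ≤ ε / 8 * (Fintype.card W : ℝ))
      = (Finset.univ.biUnion many)ᶜ := by
    ext s
    simp [hmany]
  have hcardN : (Fintype.card (Fin r → U) : ℝ) = N := by simp [hN]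
  rw [hcompl, Finset.card_compl, Nat.cast_sub (Finset.card_le_univ _), hcardN, le_div_iff₀ hN0]
  linarith
end
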